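/- arXiv:0910.5490 — 3 statements merged into one kernel-verified Lean document; each statement's English description precedes it below -/
import Mathlib

section
/- Let 0 ≤ δ < 1/4 and let (H₁, H₂, H₃) be a δ-representation of the sphere by n×n complex matrices with bott(H₁, H₂, H₃) = 0. Then there exists a unitary n×n matrix U such that ‖UH₃ − H₃U‖ ≤ 8δ and ‖U·f(H₃) − (H₁ + iH₂)‖ ≤ 2√(8δ) + 4δ, where f(H₃) denotes the Hermitian matrix obtained by applying the continuous function f(x) = √(max(1 − x², 0)) to the Hermitian matrix H₃ via the functional calculus. -/
open Matrix

noncomputable section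

namespace AC

variable {m : Type*} [Fintype m] [DecidableEq m]

/-- The ℓ² operator norm of a complex matrix. -/
def opNorm (A : Matrix m m ℂ) : ℝ :=
  ‖Matrix.toEuclideanCLM (𝕜 := ℂ) A‖

/-- `(H₁, H₂, H₃)` is a δ-representation of the sphere: each `Hᵣ` is Hermitian, all
commutators have ℓ²-operator norm at most `δ`, and `‖H₁² + H₂² + H₃² − I‖ ≤ δ`. -/
def IsSphereRep (δ : ℝ) (H₁ H₂ H₃ : Matrix m m ℂ) : Prop :=
  H₁.IsHermitian ∧ H₂.IsHermitian ∧ H₃.IsHermitian ∧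
  opNorm (H₁ * H₂ - H₂ * H₁) ≤ δ ∧
  opNorm (H₁ * H₃ - H₃ * H₁) ≤ δ ∧
  opNorm (H₂ * H₃ - H₃ * H₂) ≤ δ ∧
  opNorm (H₁ ^ 2 + H₂ ^ 2 + H₃ ^ 2 - 1) ≤ δ

/-- The 2n×2n Hermitian block matrix `S(H₁,H₂,H₃) = [[H₃, H₁ − iH₂], [H₁ + iH₂, −H₃]]`. -/
def sphS (H₁ H₂ H₃ : Matrix m m ℂ) : Matrix (m ⊕ m) (m ⊕ m) ℂ :=
  Matrix.fromBlocks H₃ (H₁ - Complex.I • H₂) (H₁ + Complex.I • H₂) (-H₃)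

open Classical in
/-- The Bott index: the number of positive eigenvalues (with multiplicity) of
`S(H₁,H₂,H₃)` minus `n`.  (Junk value `0` if `S(H₁,H₂,H₃)` is not Hermitian.) -/
def bott (H₁ H₂ H₃ : Matrix m m ℂ) : ℤ :=
  if h : (sphS H₁ H₂ H₃).IsHermitian then
    ((Finset.univ.filter fun i => 0 < h.eigenvalues i).card : ℤ) - Fintype.card m
  else 0

end AC

namespace AC

open scoped Matrix.Norms.L2Operator MatrixOrder

lemma norm_le_of_neg_algebraMap_le_of_le_algebraMap {A : Type*} [CStarAlgebra A] [PartialOrder A]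
    [StarOrderedRing A] {a : A} (ha : IsSelfAdjoint a) {r : ℝ} (hr : 0 ≤ r)
    (h₁ : -algebraMap ℝ A r ≤ a) (h₂ : a ≤ algebraMap ℝ A r) : ‖a‖ ≤ r := by
  cases subsingleton_or_nontrivial A
  · rw [Subsingleton.elim a 0, norm_zero]
    exact hr
  rcases CStarAlgebra.norm_or_neg_norm_mem_spectrum ha with h | h
  · exact (le_algebraMap_iff_spectrum_le ha).mp h₂ _ h
  · rw [← map_neg] at h₁
    linarith [(algebraMap_le_iff_le_spectrum ha).mp h₁ _ h]

lemma norm_sub_le_of_norm_mul_self_sub_le {A : Type*} [CStarAlgebra A] [PartialOrder A]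
    [StarOrderedRing A] {a b : A} (ha : 0 ≤ a) (hb : 0 ≤ b) {r : ℝ} (hr : 0 ≤ r)
    (h : ‖a * a - b * b‖ ≤ r ^ 2) : ‖a - b‖ ≤ r := by
  have key : ∀ {x y : A}, 0 ≤ x → 0 ≤ y → ‖x * x - y * y‖ ≤ r ^ 2 →
      x - y ≤ algebraMap ℝ A r := by
    intro x y hx hy hxy
    have hr' : 0 ≤ algebraMap ℝ A r := algebraMap_nonneg A hr
    have hsa : IsSelfAdjoint (x * x - y * y) :=
      (IsSelfAdjoint.of_nonneg hx |>.mul_self_nonneg |> IsSelfAdjoint.of_nonneg).sub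
        (IsSelfAdjoint.of_nonneg hy |>.mul_self_nonneg |> IsSelfAdjoint.of_nonneg)
    have h1 : x * x - y * y ≤ algebraMap ℝ A (r ^ 2) :=
      hsa.le_algebraMap_norm_self.trans (algebraMap_mono A hxy)
    have hc : y * algebraMap ℝ A r = r • y := by
      rw [Algebra.algebraMap_eq_smul_one, mul_smul_comm, mul_one]
    have h2 : x * x ≤ (y + algebraMap ℝ A r) * (y + algebraMap ℝ A r) := by
      have h3 : 0 ≤ (2 * r) • y := smul_nonneg (by positivity) hy
      have h4 : (y + algebraMap ℝ A r) * (y + algebraMap ℝ A r) =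
          y * y + algebraMap ℝ A (r ^ 2) + (2 * r) • y := by
        rw [add_mul, mul_add, mul_add, ← Algebra.commutes r y, ← Algebra.smul_def, pow_two,
          map_mul, two_mul, add_smul]
        abel
      rw [h4]
      exact (sub_le_iff_le_add'.mp h1).trans (le_add_of_nonneg_right h3)
    have h5 := CFC.sqrt_le_sqrt _ _ h2
    rw [CFC.sqrt_mul_self x hx, CFC.sqrt_mul_self _ (add_nonneg hy hr')] at h5
    exact sub_le_iff_le_add'.mpr h5
  have h1 := key ha hb h
  have h2 := key hb ha (by rwa [norm_sub_rev])
  have hsa : IsSelfAdjoint (a - b) := (IsSelfAdjoint.of_nonneg ha).sub (.of_nonneg hb)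
  refine norm_le_of_neg_algebraMap_le_of_le_algebraMap hsa hr ?_ h1
  rw [neg_le, neg_sub]
  exact h2

variable {m k : Type*} [Fintype m] [DecidableEq m] [Fintype k]

lemma exists_unitary_mul_eq {A B : Matrix m m ℂ} (h : Aᴴ * A = Bᴴ * B) :
    ∃ U ∈ unitary (Matrix m m ℂ), A = U * B := by
  set a := Matrix.toEuclideanCLM (𝕜 := ℂ) A with ha
  set b := Matrix.toEuclideanCLM (𝕜 := ℂ) B with hb
  have hab : star a * a = star b * b := by
    rw [ha, hb, ← map_star, ← map_star, ← map_mul, ← map_mul]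
    exact congrArg _ h
  have hnorm : ∀ x, ‖a x‖ = ‖b x‖ := by
    intro x
    have h1 : ∀ c : EuclideanSpace ℂ m →L[ℂ] EuclideanSpace ℂ m,
        ‖c x‖ ^ 2 = RCLike.re (inner ℂ ((star c * c) x) x) := by
      intro c
      rw [ContinuousLinearMap.star_eq_adjoint, mul_apply_eq_comp,
        ContinuousLinearMap.adjoint_inner_left, inner_self_eq_norm_sq]
    rw [← sq_eq_sq₀ (norm_nonneg _) (norm_nonneg _), h1, h1, hab]
  obtain ⟨g, hg⟩ := b.toLinearMap.rangeRestrict.exists_rightInverse_of_surjective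
    b.toLinearMap.range_rangeRestrict
  have hg' : ∀ y, b (g y) = y := fun y => congrArg Subtype.val (LinearMap.congr_fun hg y)
  let L : LinearMap.range b.toLinearMap →ₗᵢ[ℂ] EuclideanSpace ℂ m :=
    { toLinearMap := a.toLinearMap ∘ₗ g
      norm_map' := fun y => by
        change ‖a (g y)‖ = _
        rw [hnorm, hg']; rfl }
  have hL : ∀ x, L.extend (b x) = a x := by
    intro x
    have h1 := L.extend_apply ⟨b x, LinearMap.mem_range_self b.toLinearMap x⟩
    have h2 : a (g ⟨b x, LinearMap.mem_range_self b.toLinearMap x⟩) = a x := by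
      rw [← sub_eq_zero, ← map_sub, ← norm_eq_zero, hnorm, map_sub, hg', sub_self, norm_zero]
    exact h1.trans h2
  let u : EuclideanSpace ℂ m →L[ℂ] EuclideanSpace ℂ m := L.extend.toContinuousLinearMap
  have hu : star u * u = 1 := by
    rw [ContinuousLinearMap.star_eq_adjoint]
    exact (ContinuousLinearMap.norm_map_iff_adjoint_comp_self u).mp fun x => L.extend.norm_map x
  obtain ⟨U, hUu⟩ :=
    EquivLike.surjective (Matrix.toEuclideanCLM (n := m) (𝕜 := ℂ)) u
  have hinj := EquivLike.injective (Matrix.toEuclideanCLM (n := m) (𝕜 := ℂ))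
  have hU : star U * U = 1 := hinj (by rw [map_mul, map_star, hUu, hu, map_one])
  refine ⟨U, ⟨hU, mul_eq_one_comm.mp hU⟩, hinj ?_⟩
  rw [map_mul, hUu]
  ext1 x
  exact (hL x).symm

lemma l2_opNorm_le_one_of_conjTranspose_mul_self_eq_one {E : Matrix k m ℂ} (h : Eᴴ * E = 1) :
    ‖E‖ ≤ 1 := by
  have h1 := Matrix.l2_opNorm_conjTranspose_mul_self E
  rw [h] at h1
  have h2 : ‖(1 : Matrix m m ℂ)‖ ≤ 1 := by
    rw [← Matrix.diagonal_one, Matrix.l2_opNorm_diagonal]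
    exact (pi_norm_le_iff_of_nonneg zero_le_one).mpr fun _ => by simp
  nlinarith [norm_nonneg E]

lemma norm_conjTranspose_mul_mul_le [DecidableEq k] {E F : Matrix k m ℂ} (hE : Eᴴ * E = 1) (hF : Fᴴ * F = 1)
    (M : Matrix k k ℂ) : ‖Eᴴ * M * F‖ ≤ ‖M‖ := by
  have hE1 := l2_opNorm_le_one_of_conjTranspose_mul_self_eq_one hE
  have hF1 := l2_opNorm_le_one_of_conjTranspose_mul_self_eq_one hF
  rw [← Matrix.l2_opNorm_conjTranspose] at hE1
  calc _ ≤ ‖Eᴴ * M‖ * ‖F‖ := Matrix.l2_opNorm_mul _ _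
    _ ≤ ‖Eᴴ * M‖ * 1 := by gcongr
    _ ≤ ‖Eᴴ‖ * ‖M‖ * 1 := by gcongr; exact Matrix.l2_opNorm_mul _ _
    _ ≤ 1 * ‖M‖ * 1 := by gcongr
    _ = ‖M‖ := by ring

lemma norm_fromBlocks_blocks_le (A B C D : Matrix m m ℂ) :
    ‖A‖ ≤ ‖fromBlocks A B C D‖ ∧ ‖C‖ ≤ ‖fromBlocks A B C D‖ ∧
      ‖D‖ ≤ ‖fromBlocks A B C D‖ := by
  have hE : (fromRows (1 : Matrix m m ℂ) (0 : Matrix m m ℂ))ᴴ * fromRows (1 : Matrix m m ℂ) (0 : Matrix m m ℂ) = 1 := by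
    simp [conjTranspose_fromRows_eq_fromCols_conjTranspose, fromCols_mul_fromRows]
  have hF : (fromRows (0 : Matrix m m ℂ) (1 : Matrix m m ℂ))ᴴ * fromRows (0 : Matrix m m ℂ) (1 : Matrix m m ℂ) = 1 := by
    simp [conjTranspose_fromRows_eq_fromCols_conjTranspose, fromCols_mul_fromRows]
  have h11 := norm_conjTranspose_mul_mul_le hE hE (fromBlocks A B C D)
  have h21 := norm_conjTranspose_mul_mul_le hF hE (fromBlocks A B C D)
  have h22 := norm_conjTranspose_mul_mul_le hF hF (fromBlocks A B C D)
  simp only [conjTranspose_fromRows_eq_fromCols_conjTranspose, fromCols_mul_fromBlocks,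
    fromCols_mul_fromRows, conjTranspose_one, conjTranspose_zero, one_mul, zero_mul, mul_one,
    mul_zero, add_zero, zero_add] at h11 h21 h22
  exact ⟨h11, h21, h22⟩

lemma norm_fromBlocks_diagonal_le (A : Matrix m m ℂ) : ‖fromBlocks A 0 0 A‖ ≤ ‖A‖ := by
  let φ : Matrix m m ℂ →⋆ₐ[ℂ] Matrix (m ⊕ m) (m ⊕ m) ℂ :=
    { toFun := fun A => fromBlocks A 0 0 A
      map_one' := fromBlocks_one
      map_mul' := fun A B => by simp [fromBlocks_multiply]
      map_zero' := fromBlocks_zero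
      map_add' := fun A B => by simp [fromBlocks_add]
      commutes' := fun r => by
        simp [Algebra.algebraMap_eq_smul_one, ← fromBlocks_one, fromBlocks_smul]
      map_star' := fun A => by simp [star_eq_conjTranspose, fromBlocks_conjTranspose] }
  exact NonUnitalStarAlgHom.norm_apply_le φ A


lemma norm_fromBlocks_diagonal_mul_le (A : Matrix m m ℂ) {V : Matrix (m ⊕ m) (m ⊕ m) ℂ}
    (hV : V ∈ unitary (Matrix (m ⊕ m) (m ⊕ m) ℂ)) : ‖fromBlocks A 0 0 A * V‖ ≤ ‖A‖ := by
  rw [CStarRing.norm_mul_mem_unitary _ hV]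
  exact norm_fromBlocks_diagonal_le A

lemma mem_unitary_of_conjTranspose_mul_self {V : Matrix k k ℂ} [DecidableEq k] (h : Vᴴ * V = 1) :
    V ∈ unitary (Matrix k k ℂ) :=
  ⟨h, mul_eq_one_comm.mp h⟩

omit [Fintype m] [DecidableEq m] in
lemma isHermitian_sphS {H₁ H₂ H₃ : Matrix m m ℂ} (h₁ : H₁.IsHermitian) (h₂ : H₂.IsHermitian)
    (h₃ : H₃.IsHermitian) : (sphS H₁ H₂ H₃).IsHermitian := by
  refine IsHermitian.fromBlocks h₃ ?_ h₃.neg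
  rw [conjTranspose_sub, conjTranspose_smul, h₁.eq, h₂.eq]
  simp

lemma norm_sphS_mul_self_sub_one_le {δ : ℝ} {H₁ H₂ H₃ : Matrix m m ℂ}
    (h : IsSphereRep δ H₁ H₂ H₃) : ‖sphS H₁ H₂ H₃ * sphS H₁ H₂ H₃ - 1‖ ≤ 4 * δ := by
  obtain ⟨-, -, -, h12, h13, h23, hsum⟩ := h
  have hdecomp : sphS H₁ H₂ H₃ * sphS H₁ H₂ H₃ - 1 =
      fromBlocks (H₁ ^ 2 + H₂ ^ 2 + H₃ ^ 2 - 1) 0 0 (H₁ ^ 2 + H₂ ^ 2 + H₃ ^ 2 - 1) +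
      fromBlocks (H₁ * H₂ - H₂ * H₁) 0 0 (H₁ * H₂ - H₂ * H₁) *
        fromBlocks (Complex.I • 1) 0 0 (-(Complex.I • 1)) +
      fromBlocks (H₁ * H₃ - H₃ * H₁) 0 0 (H₁ * H₃ - H₃ * H₁) * fromBlocks 0 (-1) 1 0 +
      fromBlocks (H₂ * H₃ - H₃ * H₂) 0 0 (H₂ * H₃ - H₃ * H₂) *
        fromBlocks 0 (Complex.I • 1) (Complex.I • 1) 0 := by
    rw [sphS, ← fromBlocks_one, sub_eq_iff_eq_add]
    simp only [fromBlocks_multiply, fromBlocks_add]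
    congr 1 <;>
    · simp only [Matrix.mul_add, Matrix.add_mul, Matrix.mul_sub, Matrix.sub_mul, Matrix.mul_smul,
        Matrix.smul_mul, Matrix.mul_neg, Matrix.neg_mul, Matrix.mul_one, Matrix.mul_zero,
        pow_two, smul_sub, smul_add, smul_smul, smul_neg, smul_zero, Complex.I_mul_I,
        neg_smul, one_smul]
      abel
  have hI : fromBlocks (Complex.I • (1 : Matrix m m ℂ)) 0 0 (-(Complex.I • 1)) ∈
      unitary (Matrix (m ⊕ m) (m ⊕ m) ℂ) := mem_unitary_of_conjTranspose_mul_self <| by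
    simp [fromBlocks_conjTranspose, fromBlocks_multiply, smul_smul, ← fromBlocks_one]
  have hJ : fromBlocks 0 (-1 : Matrix m m ℂ) 1 0 ∈
      unitary (Matrix (m ⊕ m) (m ⊕ m) ℂ) := mem_unitary_of_conjTranspose_mul_self <| by
    simp [fromBlocks_conjTranspose, fromBlocks_multiply, ← fromBlocks_one]
  have hK : fromBlocks 0 (Complex.I • (1 : Matrix m m ℂ)) (Complex.I • 1) 0 ∈
      unitary (Matrix (m ⊕ m) (m ⊕ m) ℂ) := mem_unitary_of_conjTranspose_mul_self <| by
    simp [fromBlocks_conjTranspose, fromBlocks_multiply, smul_smul, ← fromBlocks_one]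
  rw [hdecomp]
  calc _ ≤ δ + δ + δ + δ := norm_add₄_le.trans <|
        add_le_add (add_le_add (add_le_add ((norm_fromBlocks_diagonal_le _).trans hsum)
          ((norm_fromBlocks_diagonal_mul_le _ hI).trans h12))
          ((norm_fromBlocks_diagonal_mul_le _ hJ).trans h13))
          ((norm_fromBlocks_diagonal_mul_le _ hK).trans h23)
    _ = 4 * δ := by ring

lemma exists_isometry_norm_sub_le [DecidableEq k] {S : Matrix k k ℂ} (hS : S.IsHermitian) {c : ℝ}
    (hc : ‖S * S - 1‖ ≤ c) (hcard : Fintype.card {i // 0 < hS.eigenvalues i} = Fintype.card m) :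
    ∃ W : Matrix k m ℂ, Wᴴ * W = 1 ∧ ‖2 * (W * Wᴴ) - 1 - S‖ ≤ c := by
  set l := hS.eigenvalues
  set V : Matrix k k ℂ := hS.eigenvectorUnitary.1
  have hVu : V ∈ unitary (Matrix k k ℂ) := hS.eigenvectorUnitary.2
  have hVs : star V * V = 1 := hVu.1
  have hVs' : V * star V = 1 := hVu.2
  have hspec : S = V * diagonal (fun i => (l i : ℂ)) * star V := hS.spectral_theorem
  have hnorm : ∀ d : k → ℂ, ‖V * diagonal d * star V‖ = ‖d‖ := fun d => by
    rw [CStarRing.norm_mul_mem_unitary _ (Unitary.star_mem hVu),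
      CStarRing.norm_mem_unitary_mul _ hVu, Matrix.l2_opNorm_diagonal]
  have hconj : ∀ d d' : k → ℂ, V * diagonal d * star V - V * diagonal d' * star V =
      V * diagonal (fun i => d i - d' i) * star V := fun d d' => by
    rw [← diagonal_sub, Matrix.mul_sub, Matrix.sub_mul]
  have hone : (1 : Matrix k k ℂ) = V * diagonal (fun _ => 1) * star V := by
    rw [diagonal_one, Matrix.mul_one, hVs']
  have hsq : S * S = V * diagonal (fun i => (l i : ℂ) * l i) * star V := by
    calc S * S = V * diagonal (fun i => (l i : ℂ)) * (star V * V) *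
          diagonal (fun i => (l i : ℂ)) * star V := by
          rw [hspec]; simp only [Matrix.mul_assoc]
      _ = _ := by rw [hVs, Matrix.mul_one, Matrix.mul_assoc V, diagonal_mul_diagonal]
  have heig : ∀ i, |l i * l i - 1| ≤ c := by
    intro i
    rw [hsq, hone, hconj, hnorm] at hc
    refine le_trans ?_ ((norm_le_pi_norm _ i).trans hc)
    rw [← Complex.ofReal_one, ← Complex.ofReal_mul, ← Complex.ofReal_sub, Complex.norm_real,
      Real.norm_eq_abs]
  obtain ⟨e⟩ : Nonempty (m ≃ {i // 0 < l i}) := Fintype.card_eq.mp hcard.symm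
  let E : Matrix k m ℂ := (1 : Matrix k k ℂ).submatrix id (fun j => (e j : k))
  have hE : Eᴴ * E = 1 := by
    rw [conjTranspose_submatrix, conjTranspose_one,
      ← submatrix_mul _ _ _ id _ Function.bijective_id, Matrix.one_mul]
    exact submatrix_one _ (Subtype.val_injective.comp e.injective)
  have hE' : E * Eᴴ = diagonal (fun i => if 0 < l i then 1 else 0) := by
    ext i i'
    simp only [E, mul_apply, conjTranspose_apply, submatrix_apply, id_eq, diagonal_apply, one_apply]
    rw [← e.symm.sum_comp]
    simp only [Equiv.apply_symm_apply]
    by_cases hi : 0 < l i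
    · rw [Finset.sum_eq_single_of_mem (⟨i, hi⟩ : {i // 0 < l i}) (Finset.mem_univ _)]
      · simp [hi, eq_comm]
      · intro b _ hb
        rw [if_neg fun h => hb (Subtype.ext h.symm), zero_mul]
    · rw [if_neg hi, ite_self]
      refine Finset.sum_eq_zero fun b _ => ?_
      rw [if_neg fun h : i = b => hi (h ▸ b.2), zero_mul]
  refine ⟨V * E, ?_, ?_⟩
  · calc (V * E)ᴴ * (V * E) = Eᴴ * (star V * V) * E := by
          rw [conjTranspose_mul, star_eq_conjTranspose]; simp only [Matrix.mul_assoc]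
      _ = 1 := by rw [hVs, Matrix.mul_one, hE]
  · have h2 : 2 * (V * E * (V * E)ᴴ) =
        V * diagonal (fun i => 2 * if 0 < l i then 1 else 0) * star V := by
      calc 2 * (V * E * (V * E)ᴴ) = (2 : ℂ) • (V * (E * Eᴴ) * star V) := by
            rw [conjTranspose_mul, star_eq_conjTranspose, ofNat_smul_eq_nsmul, two_smul, two_mul]
            simp only [Matrix.mul_assoc]
        _ = _ := by
            rw [hE', ← Matrix.smul_mul, ← Matrix.mul_smul, ← diagonal_smul]
            rfl
    rw [h2, hspec, hone, hconj, hconj, hnorm]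
    refine (pi_norm_le_iff_of_nonneg ((norm_nonneg _).trans hc)).mpr fun i => ?_
    have hi := heig i
    have hfac : |l i * l i - 1| = |l i - 1| * |l i + 1| := by rw [← abs_mul]; ring_nf
    split_ifs with hpos
    · have h3 : ‖(2 * 1 - 1 - l i : ℂ)‖ = |l i - 1| := by
        rw [← Real.norm_eq_abs, ← Complex.norm_real, ← norm_neg]; congr 1; push_cast; ring
      rw [h3]
      nlinarith [abs_nonneg (l i - 1), le_abs_self (l i + 1)]
    · have h3 : ‖(2 * 0 - 1 - l i : ℂ)‖ = |l i + 1| := by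
        rw [← Real.norm_eq_abs, ← Complex.norm_real, ← norm_neg]; congr 1; push_cast; ring
      rw [h3]
      nlinarith [abs_nonneg (l i + 1), neg_le_abs (l i - 1)]

lemma exists_unitary_of_isometry_blocks {A B : Matrix m m ℂ} (h : Aᴴ * A + Bᴴ * B = 1) :
    0 ≤ A * Aᴴ ∧ A * Aᴴ ≤ 1 ∧
    ∃ U ∈ unitary (Matrix m m ℂ), ∃ C : Matrix m m ℂ, 0 ≤ C ∧
      C * C = A * Aᴴ * (1 - A * Aᴴ) ∧ B * Bᴴ = U * (1 - A * Aᴴ) * star U ∧ B * Aᴴ = U * C := by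
  set Q := A * Aᴴ
  have hQ0 : 0 ≤ Q := mul_star_self_nonneg A
  set R := CFC.sqrt Q
  have hR0 : 0 ≤ R := CFC.sqrt_nonneg Q
  have hRR : R * R = Q := CFC.sqrt_mul_sqrt_self Q
  have hRH : Rᴴ = R := (IsSelfAdjoint.of_nonneg hR0).star_eq
  obtain ⟨U₁, hU₁, hA⟩ := exists_unitary_mul_eq (A := Aᴴ) (B := R) (by
    rw [conjTranspose_conjTranspose, hRH, hRR])
  have hU₁s : U₁ᴴ * U₁ = 1 := hU₁.1
  have hU₁s' : U₁ * U₁ᴴ = 1 := hU₁.2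
  have hA' : A = R * U₁ᴴ := by
    rw [← conjTranspose_conjTranspose A, hA, conjTranspose_mul, hRH]
  have hB : (B * U₁)ᴴ * (B * U₁) = 1 - Q := by
    calc (B * U₁)ᴴ * (B * U₁) = U₁ᴴ * (Bᴴ * B) * U₁ := by
          rw [conjTranspose_mul]; simp only [Matrix.mul_assoc]
      _ = U₁ᴴ * U₁ - (U₁ᴴ * U₁) * (R * R) * (U₁ᴴ * U₁) := by
          rw [eq_sub_of_add_eq' h, hA, hA', Matrix.mul_sub, Matrix.sub_mul]
          simp only [Matrix.mul_assoc, Matrix.mul_one]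
      _ = 1 - Q := by rw [hU₁s, hRR, Matrix.mul_one, Matrix.one_mul]
  have hQ1 : 0 ≤ 1 - Q := hB ▸ star_mul_self_nonneg (B * U₁)
  set T := CFC.sqrt (1 - Q)
  have hT0 : 0 ≤ T := CFC.sqrt_nonneg (1 - Q)
  have hTT : T * T = 1 - Q := CFC.sqrt_mul_sqrt_self (1 - Q)
  have hTH : Tᴴ = T := (IsSelfAdjoint.of_nonneg hT0).star_eq
  obtain ⟨U, hU, hBU⟩ := exists_unitary_mul_eq (A := B * U₁) (B := T) (by rw [hB, hTH, hTT])
  have hB' : B = U * T * U₁ᴴ := by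
    rw [← hBU, Matrix.mul_assoc, hU₁s', Matrix.mul_one]
  have hcomm : Commute T R := by
    have h1 : Commute Q (1 - Q) := (Commute.one_right Q).sub_right (Commute.refl Q)
    have h2 : Commute R (1 - Q) := h1.cfcₙ_nnreal NNReal.sqrt
    exact h2.symm.cfcₙ_nnreal NNReal.sqrt
  refine ⟨hQ0, sub_nonneg.mp hQ1, U, hU, T * R, Commute.mul_nonneg hT0 hR0 hcomm, ?_, ?_, ?_⟩
  · rw [← hTT, ← hRR, hcomm.symm.mul_mul_mul_comm,
      ((hcomm.mul_left hcomm).mul_right (hcomm.mul_left hcomm)).eq]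
  · calc B * Bᴴ = U * T * (U₁ᴴ * U₁) * Tᴴ * Uᴴ := by
          rw [hB']
          simp only [conjTranspose_mul, conjTranspose_conjTranspose, Matrix.mul_assoc]
      _ = _ := by
          rw [hU₁s, hTH, Matrix.mul_one, Matrix.mul_assoc U, hTT, star_eq_conjTranspose]
  · calc B * Aᴴ = U * T * (U₁ᴴ * U₁) * R := by
          rw [hB', hA]; simp only [Matrix.mul_assoc]
      _ = _ := by rw [hU₁s, Matrix.mul_one, Matrix.mul_assoc]

lemma norm_one_sub_mul_self_sub_cfc_le {X Y : Matrix m m ℂ} (hY : Y.IsHermitian) {c : ℝ}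
    (hc : c ≤ 1) (hX : ‖X‖ ≤ 1) (h : ‖X - Y‖ ≤ c) :
    ‖hY.cfc (fun x => √(max (1 - x ^ 2) 0)) * hY.cfc (fun x => √(max (1 - x ^ 2) 0)) -
      (1 - X * X)‖ ≤ 6 * c := by
  have hc0 : 0 ≤ c := (norm_nonneg _).trans h
  have hYn : ‖Y‖ ≤ 1 + c := by
    calc ‖Y‖ = ‖X - (X - Y)‖ := by rw [sub_sub_cancel]
      _ ≤ ‖X‖ + ‖X - Y‖ := norm_sub_le _ _
      _ ≤ 1 + c := add_le_add hX h
  have hYsa : IsSelfAdjoint Y := hY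
  have hsq : Y * Y = cfc (fun x : ℝ => x ^ 2) Y := by
    rw [cfc_pow_id Y 2, pow_two]
  have hcfc : hY.cfc (fun x => √(max (1 - x ^ 2) 0)) * hY.cfc (fun x => √(max (1 - x ^ 2) 0)) -
      (1 - Y * Y) = cfc (fun x : ℝ => max (1 - x ^ 2) 0 - (1 - x ^ 2)) Y := by
    rw [← hY.cfc_eq, ← cfc_mul _ _ Y, hsq, cfc_sub (fun x : ℝ => max (1 - x ^ 2) 0) _ Y,
      cfc_sub (fun _ : ℝ => (1 : ℝ)) _ Y, cfc_const_one ℝ Y]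
    congr 2
    ext x
    exact Real.mul_self_sqrt (le_max_right _ _)
  have h1 : ‖cfc (fun x : ℝ => max (1 - x ^ 2) 0 - (1 - x ^ 2)) Y‖ ≤ 3 * c := by
    refine norm_cfc_le (by positivity) fun x hx => ?_
    have hxn : |x| ≤ 1 + c := by
      have h1 := norm_apply_le_norm_cfc id Y hx
      rw [cfc_id ℝ Y] at h1
      exact h1.trans hYn
    have hx2 : x ^ 2 ≤ (1 + c) ^ 2 := by
      rw [← sq_abs x]
      gcongr
    rw [Real.norm_eq_abs, abs_le]
    constructor
    · linarith [le_max_left (1 - x ^ 2) 0]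
    · rw [sub_le_iff_le_add, max_le_iff]
      constructor <;> nlinarith
  have h2 : ‖X * X - Y * Y‖ ≤ 3 * c := by
    calc ‖X * X - Y * Y‖ = ‖X * (X - Y) + (X - Y) * Y‖ := by
          congr 1; noncomm_ring
      _ ≤ ‖X‖ * ‖X - Y‖ + ‖X - Y‖ * ‖Y‖ :=
          (norm_add_le _ _).trans (add_le_add (norm_mul_le _ _) (norm_mul_le _ _))
      _ ≤ 1 * c + c * (1 + c) := by gcongr
      _ ≤ 3 * c := by nlinarith
  calc _ = ‖cfc (fun x : ℝ => max (1 - x ^ 2) 0 - (1 - x ^ 2)) Y + (X * X - Y * Y)‖ := by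
        rw [← hcfc]; congr 1; abel
    _ ≤ 3 * c + 3 * c := (norm_add_le _ _).trans (add_le_add h1 h2)
    _ = 6 * c := by ring

lemma card_pos_eigenvalues_eq_of_bott_eq_zero {H₁ H₂ H₃ : Matrix m m ℂ}
    (hS : (sphS H₁ H₂ H₃).IsHermitian) (h : bott H₁ H₂ H₃ = 0) :
    Fintype.card {i // 0 < hS.eigenvalues i} = Fintype.card m := by
  rw [bott, dif_pos hS, sub_eq_zero, Nat.cast_inj] at h
  rw [← h, Fintype.card_subtype]

lemma exists_unitary_of_bott_eq_zero {δ : ℝ} (hδ : δ < 1 / 4) {H₁ H₂ H₃ : Matrix m m ℂ}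
    (hrep : IsSphereRep δ H₁ H₂ H₃) (hH₃ : H₃.IsHermitian) (hbott : bott H₁ H₂ H₃ = 0) :
    ∃ U ∈ unitary (Matrix m m ℂ), ‖U * H₃ - H₃ * U‖ ≤ 8 * δ ∧
      ‖U * hH₃.cfc (fun x => √(max (1 - x ^ 2) 0)) - (H₁ + Complex.I • H₂)‖ ≤
        2 * √(8 * δ) + 4 * δ := by
  have hS := isHermitian_sphS hrep.1 hrep.2.1 hrep.2.2.1
  obtain ⟨W, hW, hWS⟩ := exists_isometry_norm_sub_le hS (norm_sphS_mul_self_sub_one_le hrep)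
    (card_pos_eigenvalues_eq_of_bott_eq_zero hS hbott)
  obtain ⟨A, B, rfl⟩ : ∃ A B, W = fromRows A B := ⟨_, _, (fromRows_toRows W).symm⟩
  rw [conjTranspose_fromRows_eq_fromCols_conjTranspose] at hW hWS
  rw [fromCols_mul_fromRows] at hW
  have hblocks : 2 * (fromRows A B * fromCols Aᴴ Bᴴ) - 1 - sphS H₁ H₂ H₃ =
      fromBlocks (2 * (A * Aᴴ) - 1 - H₃) (2 * (A * Bᴴ) - (H₁ - Complex.I • H₂))
        (2 * (B * Aᴴ) - (H₁ + Complex.I • H₂)) (2 * (B * Bᴴ) - 1 + H₃) := by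
    rw [fromRows_mul_fromCols, sphS, ← fromBlocks_one, sub_eq_iff_eq_add, sub_eq_iff_eq_add,
      two_mul]
    simp only [fromBlocks_add]
    congr 1 <;> noncomm_ring
  rw [hblocks] at hWS
  obtain ⟨hn1, hn2, hn3⟩ := norm_fromBlocks_blocks_le (2 * (A * Aᴴ) - 1 - H₃)
    (2 * (A * Bᴴ) - (H₁ - Complex.I • H₂)) (2 * (B * Aᴴ) - (H₁ + Complex.I • H₂))
    (2 * (B * Bᴴ) - 1 + H₃)
  replace hn1 := hn1.trans hWS
  replace hn2 := hn2.trans hWS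
  replace hn3 := hn3.trans hWS
  obtain ⟨hQ0, hQ1, U, hU, C, hC0, hCC, hBB, hBA⟩ := exists_unitary_of_isometry_blocks hW
  set Q := A * Aᴴ
  have hUU : star U * U = 1 := hU.1
  refine ⟨U, hU, ?_, ?_⟩
  · have heq : U * H₃ - H₃ * U =
        -(U * (2 * Q - 1 - H₃)) - (2 * (B * Bᴴ) - 1 + H₃) * U := by
      have h1 : B * Bᴴ * U = U - U * Q := by
        rw [hBB, Matrix.mul_assoc, hUU, Matrix.mul_one, Matrix.mul_sub, Matrix.mul_one]
      have h2 : (2 * (B * Bᴴ) - 1 + H₃) * U = 2 * (B * Bᴴ * U) - U + H₃ * U := by noncomm_ring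
      rw [h2, h1]
      noncomm_ring
    rw [heq]
    calc _ ≤ ‖2 * Q - 1 - H₃‖ + ‖2 * (B * Bᴴ) - 1 + H₃‖ := by
          refine (norm_sub_le _ _).trans ?_
          rw [norm_neg, CStarRing.norm_mem_unitary_mul _ hU, CStarRing.norm_mul_mem_unitary _ hU]
      _ ≤ 4 * δ + 4 * δ := add_le_add hn1 hn3
      _ = 8 * δ := by ring
  · have hδ0 : 0 ≤ 4 * δ := (norm_nonneg _).trans hn1
    set F := hH₃.cfc (fun x => √(max (1 - x ^ 2) 0)) with hF
    have hF0 : 0 ≤ F := by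
      rw [hF, ← hH₃.cfc_eq]
      exact cfc_nonneg fun x _ => Real.sqrt_nonneg _
    have hX : ‖2 * Q - 1‖ ≤ 1 := by
      have hsa : IsSelfAdjoint (2 * Q - 1) := by
        rw [two_mul]
        exact ((IsSelfAdjoint.of_nonneg hQ0).add (.of_nonneg hQ0)).sub (.one _)
      refine norm_le_of_neg_algebraMap_le_of_le_algebraMap hsa zero_le_one ?_ ?_
      · rw [map_one, two_mul, neg_le_sub_iff_le_add, add_comm, le_add_iff_nonneg_right]
        exact add_nonneg hQ0 hQ0
      · rw [map_one, two_mul, sub_le_iff_le_add]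
        exact add_le_add hQ1 hQ1
    have hCC' : 2 * C * (2 * C) = 1 - (2 * Q - 1) * (2 * Q - 1) := by
      have h1 : 2 * C * (2 * C) = 4 * (C * C) := by noncomm_ring
      rw [h1, hCC]
      noncomm_ring
    have hFC : ‖F - 2 * C‖ ≤ 2 * √(8 * δ) := by
      refine norm_sub_le_of_norm_mul_self_sub_le hF0 ?_ (by positivity) ?_
      · rw [two_mul]
        exact add_nonneg hC0 hC0
      · rw [hCC', mul_pow, Real.sq_sqrt (by linarith)]
        exact (norm_one_sub_mul_self_sub_cfc_le hH₃ (by linarith) hX hn1).trans (by linarith)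
    have heq : U * F - (H₁ + Complex.I • H₂) =
        U * (F - 2 * C) + (2 * (B * Aᴴ) - (H₁ + Complex.I • H₂)) := by
      rw [hBA]
      noncomm_ring
    rw [heq]
    refine (norm_add_le _ _).trans (add_le_add ?_ hn2)
    rwa [CStarRing.norm_mem_unitary_mul _ hU]

end AC

/-- Lemma (`lem:toCylindrical`, spherical to cylindrical coordinates): if `(H₁,H₂,H₃)`
is a δ-representation of the sphere (`0 ≤ δ < 1/4`) with `bott(H₁,H₂,H₃) = 0`, then
there is a unitary `U` with `‖UH₃ − H₃U‖ ≤ 8δ` and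
`‖U·f(H₃) − (H₁ + iH₂)‖ ≤ 2√(8δ) + 4δ`, where `f(H₃)` is obtained by applying
`f(x) = √(max(1 − x², 0))` to `H₃` via the functional calculus. -/
theorem spherical_to_cylindrical {n : ℕ} (δ : ℝ) (hδ0 : 0 ≤ δ) (hδ : δ < 1/4)
    (H₁ H₂ H₃ : Matrix (Fin n) (Fin n) ℂ)
    (hrep : AC.IsSphereRep δ H₁ H₂ H₃)
    (hH₃ : H₃.IsHermitian)
    (hbott : AC.bott H₁ H₂ H₃ = 0) :
    ∃ U : Matrix (Fin n) (Fin n) ℂ,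
      Uᴴ * U = 1 ∧ U * Uᴴ = 1 ∧
      AC.opNorm (U * H₃ - H₃ * U) ≤ 8 * δ ∧
      AC.opNorm (U * hH₃.cfc (fun x => Real.sqrt (max (1 - x ^ 2) 0)) -
          (H₁ + Complex.I • H₂)) ≤
        2 * Real.sqrt (8 * δ) + 4 * δ := by
  obtain ⟨U, hU, h₁, h₂⟩ := AC.exists_unitary_of_bott_eq_zero hδ hrep hH₃ hbott
  exact ⟨U, hU.1, hU.2, h₁, h₂⟩
end
end

section
/- Let S be a positive half-integer with S > 4 and set n = 2S + 1. Define Hermitian n×n matrices H₁, H₂, H₃ (the normalized spin-S matrices) as follows, indexing rows and columns by j = 0, 1, …, n−1: H₁ is diagonal with (H₁)_{jj} = (S − j)/√(S(S+1)); H₂ is tridiagonal with (H₂)_{j,j+1} = (H₂)_{j+1,j} = √((j+1)(2S−j)) / (2√(S(S+1))) and all other entries zero; H₃ is tridiagonal with (H₃)_{j,j+1} = −i·√((j+1)(2S−j)) / (2√(S(S+1))), (H₃)_{j+1,j} = i·√((j+1)(2S−j)) / (2√(S(S+1))), and all other entries zero. Then for every triple (H₁′, H₂′, H₃′) of pairwise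 commuting Hermitian n×n matrices, ‖H₁′ − H₁‖ + ‖H₂′ − H₂‖ + ‖H₃′ − H₃‖ ≥ √(1 − 4/S). -/
open Matrix

noncomputable section

/-- A nontrivial subspace of dimension larger than `dim E`, on which the block operator
`[[A₁, A₂ - iA₃], [A₂ + iA₃, -A₁]]` of `E × E` acts as the scalar `μ`, bounds from below the
distance from `(A₁, A₂, A₃)` to any triple `(B₁, B₂, B₃)` with `B₁` self-adjoint and commuting with `B₂`
and `B₃`. -/
theorem le_norm_sub_of_block_eigenspace {E V : Type*} [NormedAddCommGroup E]
    [InnerProductSpace ℂ E] [FiniteDimensional ℂ E] [AddCommGroup V] [Module ℂ V]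
    [FiniteDimensional ℂ V] (hV : Module.finrank ℂ E < Module.finrank ℂ V)
    (A₁ A₂ A₃ B₁ B₂ B₃ : E →L[ℂ] E) (hB₁ : (B₁ : E →ₗ[ℂ] E).IsSymmetric)
    (h12 : B₁ * B₂ = B₂ * B₁) (h13 : B₁ * B₃ = B₃ * B₁)
    (f g : V →ₗ[ℂ] E) (hfg : ∀ x, f x = 0 → g x = 0 → x = 0) (μ : ℝ)
    (hf : ∀ x, A₁ (f x) + (A₂ (g x) - Complex.I • A₃ (g x)) = (μ : ℂ) • f x)
    (hg : ∀ x, A₂ (f x) + Complex.I • A₃ (f x) - A₁ (g x) = (μ : ℂ) • g x) :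
    μ ≤ ‖B₁ - A₁‖ + ‖B₂ - A₂‖ + ‖B₃ - A₃‖ := by
  classical
  set b := hB₁.eigenvectorBasis rfl with hb
  set e := hB₁.eigenvalues rfl with he
  have hBb : ∀ i, B₁ (b i) = (e i : ℂ) • b i := fun i => hB₁.apply_eigenvectorBasis rfl i
  let F : V →ₗ[ℂ] (Fin (Module.finrank ℂ E) → ℂ) := LinearMap.pi fun i =>
    (innerSL ℂ (b i)).toLinearMap ∘ₗ (if e i ≤ 0 then g else f)
  obtain ⟨x, hx, hx0⟩ : ∃ x, F x = 0 ∧ x ≠ 0 := by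
    have : LinearMap.ker F ≠ ⊥ := LinearMap.ker_ne_bot_of_finrank_lt (by simpa using hV)
    obtain ⟨x, hx, h0⟩ := (Submodule.ne_bot_iff _).1 this
    exact ⟨x, hx, h0⟩
  set u := f x with hu
  set w := g x with hw
  have hwneg : ∀ i, e i ≤ 0 → inner ℂ (b i) w = 0 := fun i hi => by
    simpa [F, hi] using congrFun hx i
  have hupos : ∀ i, 0 < e i → inner ℂ (b i) u = 0 := fun i hi => by
    simpa [F, hi.not_ge] using congrFun hx i
  have hinner : ∀ v v' : E, (∀ i, inner ℂ (b i) v = 0 ∨ inner ℂ (b i) v' = 0) →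
      inner ℂ v v' = 0 := fun v v' h => by
    rw [← b.sum_inner_mul_inner v v']
    refine Finset.sum_eq_zero fun i _ => ?_
    rcases h i with h | h
    · rw [inner_eq_zero_symm.1 h, zero_mul]
    · rw [h, mul_zero]
  have hoff : ∀ B : E →L[ℂ] E, B₁ * B = B * B₁ → ∀ i j, e i ≠ e j →
      inner ℂ (b i) (B (b j)) = 0 := fun B hB i j hij => by
    have h1 := congrArg (fun T : E →L[ℂ] E => inner ℂ (b i) (T (b j))) hB
    have h2 : inner ℂ (b i) (B₁ (B (b j))) = inner ℂ (B₁ (b i)) (B (b j)) := (hB₁ _ _).symm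
    simp only [mul_apply_eq_comp, h2, hBb, map_smul, inner_smul_left, inner_smul_right,
      Complex.conj_ofReal] at h1
    have h3 : (e i : ℂ) - e j ≠ 0 := by
      rw [sub_ne_zero]; exact_mod_cast hij
    exact (mul_eq_zero.1 (show ((e i : ℂ) - e j) * _ = 0 by
      rw [sub_mul, h1, sub_self])).resolve_left h3
  have hexp : ∀ (B : E →L[ℂ] E) (i) (v : E), (∀ j, inner ℂ (b j) v = 0 ∨
      inner ℂ (b i) (B (b j)) = 0) → inner ℂ (b i) (B v) = 0 := fun B i v h => by
    conv_lhs => rw [← b.sum_repr' v]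
    rw [map_sum, inner_sum]
    refine Finset.sum_eq_zero fun j _ => ?_
    rw [map_smul, inner_smul_right]
    exact mul_eq_zero.2 (h j)
  have huw : ∀ B : E →L[ℂ] E, B₁ * B = B * B₁ → inner ℂ u (B w) = 0 := fun B hB => by
    refine hinner _ _ fun i => ?_
    by_cases hi : e i ≤ 0
    · refine Or.inr (hexp B i w fun j => ?_)
      by_cases hj : e j ≤ 0
      · exact Or.inl (hwneg j hj)
      · exact Or.inr (hoff B hB i j (by intro h; rw [h] at hi; exact hj hi))
    · exact Or.inl (hupos i (not_le.1 hi))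
  have hwu : ∀ B : E →L[ℂ] E, B₁ * B = B * B₁ → inner ℂ w (B u) = 0 := fun B hB => by
    refine hinner _ _ fun i => ?_
    by_cases hi : e i ≤ 0
    · exact Or.inl (hwneg i hi)
    · refine Or.inr (hexp B i u fun j => ?_)
      by_cases hj : e j ≤ 0
      · exact Or.inr (hoff B hB i j (by intro h; rw [h] at hi; exact hi hj))
      · exact Or.inl (hupos j (not_le.1 hj))
  have hquad : ∀ v : E, (inner ℂ v (B₁ v)).re = ∑ i, e i * ‖inner ℂ (b i) v‖ ^ 2 := fun v => by
    rw [← b.sum_inner_mul_inner v (B₁ v), Complex.re_sum]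
    refine Finset.sum_congr rfl fun i _ => ?_
    have h2 : inner ℂ (b i) (B₁ v) = inner ℂ (B₁ (b i)) v := (hB₁ _ _).symm
    rw [h2, hBb, inner_smul_left, Complex.conj_ofReal, mul_left_comm, Complex.re_ofReal_mul,
      ← inner_conj_symm v (b i), ← Complex.normSq_eq_conj_mul_self, Complex.ofReal_re,
      Complex.normSq_eq_norm_sq]
  have huB : (inner ℂ u (B₁ u)).re ≤ 0 := by
    rw [hquad]
    refine Finset.sum_nonpos fun i _ => ?_
    rcases le_or_gt (e i) 0 with h | h
    · exact mul_nonpos_of_nonpos_of_nonneg h (sq_nonneg _)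
    · simp [hupos i h]
  have hwB : 0 ≤ (inner ℂ w (B₁ w)).re := by
    rw [hquad]
    refine Finset.sum_nonneg fun i _ => ?_
    rcases le_or_gt (e i) 0 with h | h
    · simp [hwneg i h]
    · positivity
  have hbound : ∀ (D : E →L[ℂ] E) (v v' : E), ‖inner ℂ v (D v')‖ ≤ ‖D‖ * (‖v‖ * ‖v'‖) :=
    fun D v v' => by
      calc _ ≤ ‖v‖ * ‖D v'‖ := norm_inner_le_norm _ _
        _ ≤ ‖v‖ * (‖D‖ * ‖v'‖) := by gcongr; exact D.le_opNorm _
        _ = _ := by ring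
  have e1 := congrArg (fun v => (inner ℂ u v).re) (hf x)
  have e2 := congrArg (fun v => (inner ℂ w v).re) (hg x)
  rw [← hu, ← hw] at e1 e2
  have hself : ∀ v : E, inner ℂ v v = ((‖v‖ ^ 2 : ℝ) : ℂ) := fun v => by
    rw [inner_self_eq_norm_sq_to_K]
    norm_cast
  simp only [inner_add_right, inner_sub_right, inner_smul_right, hself, Complex.add_re,
    Complex.sub_re, Complex.mul_re, Complex.I_re, Complex.I_im, Complex.ofReal_re,
    Complex.ofReal_im] at e1 e2
  have n1 := (neg_le_abs _).trans ((Complex.abs_re_le_norm _).trans (hbound (B₁ - A₁) u u))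
  have n2 := (le_abs_self _).trans ((Complex.abs_re_le_norm _).trans (hbound (B₁ - A₁) w w))
  have n3 := (neg_le_abs _).trans ((Complex.abs_re_le_norm _).trans (hbound (B₂ - A₂) u w))
  have n4 := (neg_le_abs _).trans ((Complex.abs_re_le_norm _).trans (hbound (B₂ - A₂) w u))
  have n5 := (neg_le_abs _).trans ((Complex.abs_im_le_norm _).trans (hbound (B₃ - A₃) u w))
  have n6 := (le_abs_self _).trans ((Complex.abs_im_le_norm _).trans (hbound (B₃ - A₃) w u))
  simp only [_root_.sub_apply, inner_sub_right, huw B₂ h12, huw B₃ h13, hwu B₂ h12,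
    hwu B₃ h13, Complex.sub_re, Complex.sub_im, Complex.zero_re,
    Complex.zero_im] at n1 n2 n3 n4 n5 n6
  have hpos : 0 < ‖u‖ ^ 2 + ‖w‖ ^ 2 := by
    by_contra hn
    refine hx0 (hfg x ?_ ?_)
    · exact norm_eq_zero.1 (by nlinarith [sq_nonneg ‖u‖, sq_nonneg ‖w‖])
    · exact norm_eq_zero.1 (by nlinarith [sq_nonneg ‖u‖, sq_nonneg ‖w‖])
  have hcr : ∀ D : E →L[ℂ] E, ‖D‖ * (‖u‖ * ‖w‖) + ‖D‖ * (‖w‖ * ‖u‖) ≤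
      ‖D‖ * (‖u‖ ^ 2 + ‖w‖ ^ 2) := fun D => by
    nlinarith [norm_nonneg D, mul_nonneg (norm_nonneg D) (sq_nonneg (‖u‖ - ‖w‖))]
  have c2 := hcr (B₂ - A₂)
  have c3 := hcr (B₃ - A₃)
  refine le_of_mul_le_mul_right ?_ hpos
  linarith

/-- The linear map sending `x` to the upper component `j ↦ √(2S + 1 - j) x_j` of the spin-`S + 1/2`
subspace. -/
def spinUpper (a : ℕ) (S : ℝ) : (Fin (a + 2) → ℂ) →ₗ[ℂ] EuclideanSpace ℂ (Fin (a + 1)) :=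
  (WithLp.linearEquiv 2 ℂ (Fin (a + 1) → ℂ)).symm.toLinearMap ∘ₗ
    LinearMap.pi fun j => ((√(2 * S + 1 - (j : ℕ)) : ℝ) : ℂ) • LinearMap.proj j.castSucc

/-- The linear map sending `x` to the lower component `j ↦ √(j + 1) x_{j + 1}` of the spin-`S + 1/2`
subspace. -/
def spinLower (a : ℕ) : (Fin (a + 2) → ℂ) →ₗ[ℂ] EuclideanSpace ℂ (Fin (a + 1)) :=
  (WithLp.linearEquiv 2 ℂ (Fin (a + 1) → ℂ)).symm.toLinearMap ∘ₗ
    LinearMap.pi fun j => ((√((j : ℕ) + 1) : ℝ) : ℂ) • LinearMap.proj j.succ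

theorem spinUpper_apply (a : ℕ) (S : ℝ) (x : Fin (a + 2) → ℂ) (j : Fin (a + 1)) :
    spinUpper a S x j = ((√(2 * S + 1 - (j : ℕ)) : ℝ) : ℂ) * x j.castSucc := rfl

theorem spinLower_apply (a : ℕ) (x : Fin (a + 2) → ℂ) (j : Fin (a + 1)) :
    spinLower a x j = ((√((j : ℕ) + 1) : ℝ) : ℂ) * x j.succ := rfl

theorem eq_zero_of_spinUpper_spinLower (a : ℕ) (S : ℝ) (hSa : S = a / 2) (x : Fin (a + 2) → ℂ)
    (hf : spinUpper a S x = 0) (hg : spinLower a x = 0) : x = 0 := by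
  funext i
  refine Fin.cases ?_ (fun j => ?_) i
  · have h := congrArg (fun v : EuclideanSpace ℂ (Fin (a + 1)) => v 0) hf
    simp only [spinUpper_apply, PiLp.zero_apply, mul_eq_zero, Complex.ofReal_eq_zero] at h
    refine h.resolve_left (Real.sqrt_pos.2 ?_).ne'
    rw [hSa]
    simp
    positivity
  · have h := congrArg (fun v : EuclideanSpace ℂ (Fin (a + 1)) => v j) hg
    simp only [spinLower_apply, PiLp.zero_apply, mul_eq_zero, Complex.ofReal_eq_zero] at h
    exact h.resolve_left (Real.sqrt_pos.2 (by positivity)).ne'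

theorem sum_subdiag {a : ℕ} (d : ℕ → ℂ) (w : Fin (a + 1) → ℂ) (k : Fin a) :
    ∑ j : Fin (a + 1), (if (k.succ : ℕ) = (j : ℕ) + 1 then d j else 0) * w j =
      d k * w k.castSucc := by
  rw [Finset.sum_eq_single k.castSucc]
  · simp
  · intro j _ hj
    rw [if_neg, zero_mul]
    intro h
    exact hj (Fin.ext (by simp at h ⊢; omega))
  · simp

theorem sum_superdiag {a : ℕ} (d : ℂ) (u : Fin (a + 1) → ℂ) (k : Fin a) :
    ∑ j : Fin (a + 1), (if (j : ℕ) = (k.castSucc : ℕ) + 1 then d else 0) * u j =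
      d * u k.succ := by
  rw [Finset.sum_eq_single k.succ]
  · simp
  · intro j _ hj
    rw [if_neg, zero_mul]
    intro h
    exact hj (Fin.ext (by simp at h ⊢; omega))
  · simp

theorem sub_I_mul_tridiag {a : ℕ} (c : ℕ → ℝ) (i j : Fin (a + 1)) (t : ℂ) :
    (if (j : ℕ) = (i : ℕ) + 1 then ((c (i : ℕ) : ℝ) : ℂ)
      else if (i : ℕ) = (j : ℕ) + 1 then ((c (j : ℕ) : ℝ) : ℂ) else 0) * t -
    Complex.I * ((if (j : ℕ) = (i : ℕ) + 1 then -Complex.I * ((c (i : ℕ) : ℝ) : ℂ)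
      else if (i : ℕ) = (j : ℕ) + 1 then Complex.I * ((c (j : ℕ) : ℝ) : ℂ) else 0) * t) =
    (if (i : ℕ) = (j : ℕ) + 1 then ((2 * c (j : ℕ) : ℝ) : ℂ) else 0) * t := by
  split_ifs
  · omega
  · linear_combination t * c i * Complex.I_sq
  · push_cast
    linear_combination (-1 : ℂ) * t * c j * Complex.I_sq
  · simp

theorem add_I_mul_tridiag {a : ℕ} (c : ℕ → ℝ) (i j : Fin (a + 1)) (t : ℂ) :
    (if (j : ℕ) = (i : ℕ) + 1 then ((c (i : ℕ) : ℝ) : ℂ)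
      else if (i : ℕ) = (j : ℕ) + 1 then ((c (j : ℕ) : ℝ) : ℂ) else 0) * t +
    Complex.I * ((if (j : ℕ) = (i : ℕ) + 1 then -Complex.I * ((c (i : ℕ) : ℝ) : ℂ)
      else if (i : ℕ) = (j : ℕ) + 1 then Complex.I * ((c (j : ℕ) : ℝ) : ℂ) else 0) * t) =
    (if (j : ℕ) = (i : ℕ) + 1 then ((2 * c (i : ℕ) : ℝ) : ℂ) else 0) * t := by
  split_ifs
  · push_cast
    linear_combination (-1 : ℂ) * t * c i * Complex.I_sq
  · linear_combination t * c j * Complex.I_sq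
  · simp

/-- Example `exa:basicExample`: for the normalized spin-`S` matrices
`Hᵣ = Sʳ/√(S(S+1))` (with `S > 4` a half-integer, `n = 2S+1`), every triple of pairwise
commuting Hermitian `n×n` matrices `(K₁,K₂,K₃)` satisfies
`‖K₁ − H₁‖ + ‖K₂ − H₂‖ + ‖K₃ − H₃‖ ≥ √(1 − 4/S)`.  Here `a = 2S ∈ ℕ`, rows and columns
are indexed by `j = 0,…,n−1`, `H₁` is diagonal with entries `(S−j)/√(S(S+1))`, and
`H₂`, `H₃` are tridiagonal with off-diagonal data built from
`c j = √((j+1)(2S−j))/(2√(S(S+1)))`. -/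
theorem spin_matrices_far_from_commuting (a : ℕ) (S : ℝ) (hSa : S = a / 2) (hS4 : 4 < S)
    (c : ℕ → ℝ)
    (hc : ∀ j : ℕ, c j = Real.sqrt ((j + 1) * (2 * S - j)) / (2 * Real.sqrt (S * (S + 1))))
    (H₁ H₂ H₃ : Matrix (Fin (a + 1)) (Fin (a + 1)) ℂ)
    (hH₁ : H₁ = Matrix.diagonal fun j : Fin (a + 1) =>
      (((S - (j : ℕ)) / Real.sqrt (S * (S + 1)) : ℝ) : ℂ))
    (hH₂ : H₂ = Matrix.of fun i j : Fin (a + 1) =>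
      if (j : ℕ) = (i : ℕ) + 1 then ((c (i : ℕ) : ℝ) : ℂ)
      else if (i : ℕ) = (j : ℕ) + 1 then ((c (j : ℕ) : ℝ) : ℂ) else 0)
    (hH₃ : H₃ = Matrix.of fun i j : Fin (a + 1) =>
      if (j : ℕ) = (i : ℕ) + 1 then -Complex.I * ((c (i : ℕ) : ℝ) : ℂ)
      else if (i : ℕ) = (j : ℕ) + 1 then Complex.I * ((c (j : ℕ) : ℝ) : ℂ) else 0)
    (K₁ K₂ K₃ : Matrix (Fin (a + 1)) (Fin (a + 1)) ℂ)
    (hK₁ : K₁.IsHermitian) (hK₂ : K₂.IsHermitian) (hK₃ : K₃.IsHermitian)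
    (h12 : K₁ * K₂ = K₂ * K₁) (h13 : K₁ * K₃ = K₃ * K₁) (h23 : K₂ * K₃ = K₃ * K₂) :
    Real.sqrt (1 - 4 / S) ≤
      AC.opNorm (K₁ - H₁) + AC.opNorm (K₂ - H₂) + AC.opNorm (K₃ - H₃) := by
  subst hH₁ hH₂ hH₃
  set N := √(S * (S + 1)) with hN
  have hN0 : 0 < N := Real.sqrt_pos.2 (by positivity)
  have hcS : ∀ j : ℕ, j ≤ a → 2 * c j = √((j : ℝ) + 1) * √(2 * S - j) / N := fun j hj => by
    rw [hc, Real.sqrt_mul (by positivity)]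
    field_simp
  have hlow : √(1 - 4 / S) ≤ S / N := by
    refine Real.sqrt_le_iff.2 ⟨by positivity, ?_⟩
    rw [div_pow, hN, Real.sq_sqrt (by positivity)]
    rw [le_div_iff₀ (by positivity)]
    field_simp
    nlinarith
  refine hlow.trans ?_
  unfold AC.opNorm
  simp only [map_sub]
  refine le_norm_sub_of_block_eigenspace (V := Fin (a + 2) → ℂ) (by simp) _ _ _ _ _ _ ?_ ?_ ?_
    (spinUpper a S) (spinLower a) (eq_zero_of_spinUpper_spinLower a S hSa) _ ?_ ?_
  · exact Matrix.isSymmetric_toEuclideanLin_iff.2 hK₁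
  · rw [← map_mul, h12, map_mul]
  · rw [← map_mul, h13, map_mul]
  · intro x
    ext i
    simp only [PiLp.add_apply, PiLp.sub_apply, PiLp.smul_apply, Matrix.ofLp_toEuclideanCLM,
      Matrix.mulVec_diagonal, smul_eq_mul]
    simp only [Matrix.mulVec, dotProduct, Matrix.of_apply]
    rw [Finset.mul_sum, ← Finset.sum_sub_distrib]
    simp only [sub_I_mul_tridiag]
    refine Fin.cases ?_ (fun k => ?_) i
    · simp
    · rw [sum_subdiag (fun j => ((2 * c j : ℝ) : ℂ)), hcS _ k.2.le, spinUpper_apply,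
        spinLower_apply]
      have hk : (2 * S + 1 - ((k.succ : ℕ) : ℝ)) = 2 * S - (k : ℕ) := by
        simp only [Fin.val_succ]; push_cast; ring
      have hs : ((√((k : ℕ) + 1 : ℝ) : ℝ) : ℂ) ^ 2 = ((k : ℕ) : ℂ) + 1 := by
        rw [← Complex.ofReal_pow, Real.sq_sqrt (by positivity)]
        push_cast; rfl
      have hN0' : (N : ℂ) ≠ 0 := by exact_mod_cast hN0.ne'
      rw [hk, Fin.succ_castSucc]
      simp only [Fin.val_succ, Fin.val_castSucc]
      push_cast
      field_simp
      linear_combination (√(2 * S - (k : ℕ)) : ℂ) * x k.succ.castSucc * hs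
  · intro x
    ext i
    simp only [PiLp.add_apply, PiLp.sub_apply, PiLp.smul_apply, Matrix.ofLp_toEuclideanCLM,
      Matrix.mulVec_diagonal, smul_eq_mul]
    simp only [Matrix.mulVec, dotProduct, Matrix.of_apply]
    rw [Finset.mul_sum, ← Finset.sum_add_distrib]
    simp only [add_I_mul_tridiag]
    have hN0' : (N : ℂ) ≠ 0 := by exact_mod_cast hN0.ne'
    refine Fin.lastCases ?_ (fun k => ?_) i
    · rw [Finset.sum_eq_zero fun j _ => by
        rw [if_neg (by simp; omega), zero_mul]]
      have hS : (a : ℂ) = 2 * S := by rw [hSa]; push_cast; ring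
      simp only [Fin.val_last]
      push_cast
      rw [hS]
      ring
    · rw [sum_superdiag, Fin.val_castSucc, hcS _ k.2.le, spinUpper_apply,
        spinLower_apply]
      have hk : (2 * S + 1 - ((k.succ : ℕ) : ℝ)) = 2 * S - (k : ℕ) := by
        simp only [Fin.val_succ]; push_cast; ring
      have hka : ((k : ℕ) : ℝ) ≤ a := by exact_mod_cast k.2.le
      have hs : ((√(2 * S - (k : ℕ)) : ℝ) : ℂ) ^ 2 = 2 * S - ((k : ℕ) : ℂ) := by
        rw [← Complex.ofReal_pow, Real.sq_sqrt (by rw [hSa]; linarith)]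
        push_cast; rfl
      rw [hk, Fin.succ_castSucc]
      simp only [Fin.val_castSucc]
      push_cast
      field_simp
      linear_combination x k.succ.castSucc * hs
end
end

section
/- There exist a complex Hilbert space ℋ, bounded self-adjoint operators H₁, H₂, H₃ on ℋ that pairwise commute, and an increasing sequence P₁ ≤ P₂ ≤ … of finite-rank orthogonal projections on ℋ such that: (1) P_n converges to the identity operator in the strong operator topology; (2) for r = 1, 2, 3, ‖P_n H_r − H_r P_n‖ → 0 as n → ∞; and (3) setting d_n = inf { ‖K₁ − P_n H₁ P_n‖ + ‖K₂ − P_n H₂ P_n‖ + ‖K₃ − P_n H₃ P_n‖ : K₁, K₂, K₃ bounded self-adjoint operators on ℋ with K₁K₂ = K₂K₁, K₁K₃ = K₃K₁, K₂K₃ = K₃K₂ }, one has d_n → 1 as n → ∞. -/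
open Matrix

noncomputable section

open scoped InnerProductSpace
open Filter Topology

theorem Submodule.commute_starProjection_of_mapsTo {H : Type*} [NormedAddCommGroup H]
    [InnerProductSpace ℂ H] [CompleteSpace H] {S : H →L[ℂ] H} (hS : IsSelfAdjoint S)
    {U : Submodule ℂ H} [U.HasOrthogonalProjection] (hU : ∀ v ∈ U, S v ∈ U) :
    Commute S U.starProjection := by
  ext v
  symm
  refine U.eq_starProjection_of_mem_of_inner_eq_zero
    (hU _ (U.starProjection_apply_mem v)) fun w hw => ?_
  change ⟪S v - S (U.starProjection v), w⟫_ℂ = 0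
  rw [← map_sub, ← ContinuousLinearMap.adjoint_inner_right, hS.adjoint_eq]
  exact U.starProjection_inner_eq_zero v _ (hU w hw)

/-- A self-adjoint operator is split into a nonnegative and a nonpositive part by a projection
commuting with everything that commutes with the operator. -/
theorem IsSelfAdjoint.exists_splitting {H : Type*} [NormedAddCommGroup H]
    [InnerProductSpace ℂ H] [CompleteSpace H] {T : H →L[ℂ] H} (hT : IsSelfAdjoint T) :
    ∃ E : H →L[ℂ] H, IsSelfAdjoint E ∧ E * E = E ∧
      (∀ S : H →L[ℂ] H, IsSelfAdjoint S → Commute S T → Commute S E) ∧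
      (∀ v, E v = v → 0 ≤ (⟪T v, v⟫_ℂ).re) ∧ (∀ v, E v = 0 → (⟪T v, v⟫_ℂ).re ≤ 0) := by
  set K : Submodule ℂ H := LinearMap.ker (T⁺ : H →L[ℂ] H).toLinearMap with hK
  have hKc : IsClosed (K : Set H) := (T⁺ : H →L[ℂ] H).isClosed_ker
  have : CompleteSpace K := hKc.completeSpace_coe
  have hmem : ∀ v, v ∈ K ↔ (T⁺ : H →L[ℂ] H) v = 0 := fun v => LinearMap.mem_ker
  have hKproj : ∀ v, K.starProjection v = v → v ∈ K := fun v hv =>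
    Submodule.starProjection_eq_self_iff.mp hv
  have hsub : (T⁺ : H →L[ℂ] H) - T⁻ = T := CFC.posPart_sub_negPart T hT
  have hpn : (T⁺ : H →L[ℂ] H) * T⁻ = 0 := CFC.posPart_mul_negPart T
  have hcomm : ∀ S : H →L[ℂ] H, IsSelfAdjoint S → Commute S T →
      Commute S K.starProjection := by
    intro S hS hST
    have hSp : Commute (T⁺ : H →L[ℂ] H) S := hT.commute_cfcₙ hST.symm _
    refine Submodule.commute_starProjection_of_mapsTo hS fun v hv => ?_
    rw [hmem] at hv ⊢
    have := congrArg (fun A : H →L[ℂ] H => A v) hSp.eq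
    simpa [hv] using this
  have hpos : ∀ v, 0 ≤ (⟪(T⁺ : H →L[ℂ] H) v, v⟫_ℂ).re := fun v =>
    ((ContinuousLinearMap.nonneg_iff_isPositive _).mp (CFC.posPart_nonneg T)).re_inner_nonneg_left v
  have hneg : ∀ v, 0 ≤ (⟪(T⁻ : H →L[ℂ] H) v, v⟫_ℂ).re := fun v =>
    ((ContinuousLinearMap.nonneg_iff_isPositive _).mp (CFC.negPart_nonneg T)).re_inner_nonneg_left v
  have hTv : ∀ v, T v = (T⁺ : H →L[ℂ] H) v - (T⁻ : H →L[ℂ] H) v := fun v => by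
    conv_lhs => rw [← hsub]
    rfl
  refine ⟨1 - K.starProjection, ?_, ?_, ?_, ?_, ?_⟩
  · exact (IsSelfAdjoint.one _).sub (isSelfAdjoint_starProjection K)
  · exact K.isIdempotentElem_starProjection.one_sub
  · intro S hS hST
    exact (Commute.one_right S).sub_right (hcomm S hS hST)
  · intro v hv
    have hv' : K.starProjection v = 0 := by
      simpa using hv
    have hnc : Commute (T⁻ : H →L[ℂ] H) K.starProjection :=
      hcomm _ (CFC.negPart_nonneg T).isSelfAdjoint (hT.commute_cfcₙ (Commute.refl T) _)
    have h1 : K.starProjection ((T⁻ : H →L[ℂ] H) v) = 0 := by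
      have := congrArg (fun A : H →L[ℂ] H => A v) hnc.eq
      simpa [hv'] using this.symm
    have h2 : (T⁻ : H →L[ℂ] H) v ∈ K := by
      rw [hmem]
      exact congrArg (fun A : H →L[ℂ] H => A v) hpn
    rw [Submodule.starProjection_eq_self_iff.mpr h2] at h1
    rw [hTv, h1, sub_zero]
    exact hpos v
  · intro v hv
    have h1 : v ∈ K := by
      refine hKproj v ?_
      exact (sub_eq_zero.mp hv).symm
    rw [hTv, (hmem v).mp h1, zero_sub, inner_neg_left, Complex.neg_re]
    exact neg_nonpos.mpr (hneg v)

/-- The quadratic form of `A₁ ⊗ σ₁ + A₂ ⊗ σ₂ + A₃ ⊗ σ₃` (Pauli matrices) on `H ⊕ H`. -/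
def pauliForm {H : Type*} [NormedAddCommGroup H] [InnerProductSpace ℂ H]
    (A₁ A₂ A₃ : H →L[ℂ] H) (x y : H) : ℝ :=
  (⟪A₃ x, x⟫_ℂ).re - (⟪A₃ y, y⟫_ℂ).re + 2 * (⟪(A₁ + Complex.I • A₂) x, y⟫_ℂ).re

section PauliForm

variable {H : Type*} [NormedAddCommGroup H] [InnerProductSpace ℂ H]

theorem pauliForm_sub (A₁ A₂ A₃ B₁ B₂ B₃ : H →L[ℂ] H) (x y : H) :
    pauliForm (A₁ - B₁) (A₂ - B₂) (A₃ - B₃) x y =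
      pauliForm A₁ A₂ A₃ x y - pauliForm B₁ B₂ B₃ x y := by
  simp only [pauliForm, _root_.sub_apply, _root_.add_apply, _root_.smul_apply,
    inner_sub_left, inner_add_left, smul_sub, Complex.sub_re, Complex.add_re]
  ring

theorem pauliForm_le_of_norm_le {A₁ A₂ A₃ : H →L[ℂ] H} {x y : H} {a₁ a₂ a₃ : ℝ}
    (h₁ : ‖A₁ x‖ ≤ a₁ * ‖x‖) (h₂ : ‖A₂ x‖ ≤ a₂ * ‖x‖) (h₃ : ‖A₃ x‖ ≤ a₃ * ‖x‖)
    (h₃' : ‖A₃ y‖ ≤ a₃ * ‖y‖) (ha : 0 ≤ a₁ + a₂) :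
    pauliForm A₁ A₂ A₃ x y ≤ (a₁ + a₂ + a₃) * (‖x‖ ^ 2 + ‖y‖ ^ 2) := by
  have e₁ : (⟪A₃ x, x⟫_ℂ).re ≤ a₃ * ‖x‖ ^ 2 :=
    calc (⟪A₃ x, x⟫_ℂ).re ≤ ‖A₃ x‖ * ‖x‖ := re_inner_le_norm (𝕜 := ℂ) _ _
      _ ≤ a₃ * ‖x‖ * ‖x‖ := by gcongr
      _ = a₃ * ‖x‖ ^ 2 := by ring
  have e₂ : -(⟪A₃ y, y⟫_ℂ).re ≤ a₃ * ‖y‖ ^ 2 :=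
    calc -(⟪A₃ y, y⟫_ℂ).re ≤ ‖A₃ y‖ * ‖y‖ :=
          (neg_le_abs _).trans ((Complex.abs_re_le_norm _).trans (norm_inner_le_norm _ _))
      _ ≤ a₃ * ‖y‖ * ‖y‖ := by gcongr
      _ = a₃ * ‖y‖ ^ 2 := by ring
  have hN : ‖(A₁ + Complex.I • A₂) x‖ ≤ (a₁ + a₂) * ‖x‖ := by
    calc ‖(A₁ + Complex.I • A₂) x‖ ≤ ‖A₁ x‖ + ‖Complex.I • A₂ x‖ := norm_add_le _ _
      _ = ‖A₁ x‖ + ‖A₂ x‖ := by rw [norm_smul, Complex.norm_I, one_mul]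
      _ ≤ (a₁ + a₂) * ‖x‖ := by linarith
  have e₃ : (⟪(A₁ + Complex.I • A₂) x, y⟫_ℂ).re ≤ (a₁ + a₂) * (‖x‖ * ‖y‖) :=
    calc (⟪(A₁ + Complex.I • A₂) x, y⟫_ℂ).re ≤ ‖(A₁ + Complex.I • A₂) x‖ * ‖y‖ :=
          re_inner_le_norm (𝕜 := ℂ) _ _
      _ ≤ (a₁ + a₂) * ‖x‖ * ‖y‖ := by gcongr
      _ = (a₁ + a₂) * (‖x‖ * ‖y‖) := by ring
  have e₄ := mul_nonneg ha (sq_nonneg (‖x‖ - ‖y‖))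
  unfold pauliForm
  linarith

variable [CompleteSpace H]

/-- A projection commuting with the operators block-diagonalises the Pauli form. -/
theorem pauliForm_eq_add {K₁ K₂ K₃ Q : H →L[ℂ] H} (hQ : IsSelfAdjoint Q) (hQQ : Q * Q = Q)
    (h₁ : Commute K₁ Q) (h₂ : Commute K₂ Q) (h₃ : Commute K₃ Q) (x y : H) :
    pauliForm K₁ K₂ K₃ x y =
      pauliForm K₁ K₂ K₃ (Q x) (Q y) + pauliForm K₁ K₂ K₃ (x - Q x) (y - Q y) := by
  have key : ∀ K : H →L[ℂ] H, Commute K Q → ∀ u v : H,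
      ⟪K u, v⟫_ℂ = ⟪K (Q u), Q v⟫_ℂ + ⟪K (u - Q u), v - Q v⟫_ℂ := by
    intro K hK u v
    have hQa : ∀ a b, ⟪Q a, b⟫_ℂ = ⟪a, Q b⟫_ℂ := fun a b => hQ.isSymmetric a b
    have hKQ : ∀ a, K (Q a) = Q (K a) := fun a => congrArg (fun A : H →L[ℂ] H => A a) hK.eq
    have hQ2 : ∀ a, Q (Q a) = Q a := fun a => congrArg (fun A : H →L[ℂ] H => A a) hQQ
    simp only [map_sub, inner_sub_left, inner_sub_right, hKQ, hQa, hQ2]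
    ring
  have hN : Commute (K₁ + Complex.I • K₂) Q := h₁.add_left (h₂.smul_left _)
  unfold pauliForm
  rw [key _ h₃ x x, key _ h₃ y y, key _ hN x y]
  simp only [Complex.add_re]
  ring

/-- If the Pauli form of `(A₁, A₂, A₃)` is bounded below by `δ` on a space whose dimension exceeds
the rank of the triple, then the triple has distance at least `δ / 4` from the commuting ones. -/
theorem le_dist_commuting_of_pauliForm {Y Z : Type*} [AddCommGroup Y] [Module ℂ Y]
    [FiniteDimensional ℂ Y] [AddCommGroup Z] [Module ℂ Z] [FiniteDimensional ℂ Z]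
    {A₁ A₂ A₃ K₁ K₂ K₃ : H →L[ℂ] H} {δ : ℝ} (hδ : 0 < δ) (κ : H →ₗ[ℂ] Z)
    (hκ : ∀ v, κ v = 0 → A₁ v = 0 ∧ A₂ v = 0 ∧ A₃ v = 0) (x y : Y →ₗ[ℂ] H)
    (hZY : Module.finrank ℂ Z < Module.finrank ℂ Y)
    (hxy : ∀ c, c ≠ 0 → x c ≠ 0 ∨ y c ≠ 0)
    (hform : ∀ c, δ * (‖x c‖ ^ 2 + ‖y c‖ ^ 2) ≤ pauliForm A₁ A₂ A₃ (x c) (y c))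
    (s₁ : IsSelfAdjoint K₁) (s₂ : IsSelfAdjoint K₂) (s₃ : IsSelfAdjoint K₃)
    (c₁₂ : Commute K₁ K₂) (c₁₃ : Commute K₁ K₃) (c₂₃ : Commute K₂ K₃) :
    δ / 4 ≤ ‖K₁ - A₁‖ + ‖K₂ - A₂‖ + ‖K₃ - A₃‖ := by
  by_contra! hlt
  set ε := δ / 4 with hε
  set T : H →L[ℂ] H := K₁ * K₁ + K₂ * K₂ + K₃ * K₃ - ((ε ^ 2 : ℝ) : ℂ) • 1 with hT
  have sT : IsSelfAdjoint T := by
    have hsq : ∀ K : H →L[ℂ] H, IsSelfAdjoint K → IsSelfAdjoint (K * K) := fun K hK => by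
      simpa [pow_two] using hK.pow 2
    refine (((hsq _ s₁).add (hsq _ s₂)).add (hsq _ s₃)).sub ?_
    exact IsSelfAdjoint.smul (Complex.conj_ofReal _) (IsSelfAdjoint.one _)
  have comm_T : ∀ S : H →L[ℂ] H, Commute S K₁ → Commute S K₂ → Commute S K₃ → Commute S T := by
    intro S h₁ h₂ h₃
    exact (((h₁.mul_right h₁).add_right (h₂.mul_right h₂)).add_right (h₃.mul_right h₃)).sub_right
      ((Commute.one_right S).smul_right _)
  have hTv : ∀ v, (⟪T v, v⟫_ℂ).re = ‖K₁ v‖ ^ 2 + ‖K₂ v‖ ^ 2 + ‖K₃ v‖ ^ 2 - ε ^ 2 * ‖v‖ ^ 2 := by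
    intro v
    have hsq : ∀ K : H →L[ℂ] H, IsSelfAdjoint K → ⟪K (K v), v⟫_ℂ = ((‖K v‖ ^ 2 : ℝ) : ℂ) := by
      intro K hK
      rw [show ⟪K (K v), v⟫_ℂ = ⟪K v, K v⟫_ℂ from hK.isSymmetric _ _, inner_self_eq_norm_sq_to_K]
      push_cast
      rfl
    have : ⟪T v, v⟫_ℂ = ⟪K₁ (K₁ v), v⟫_ℂ + ⟪K₂ (K₂ v), v⟫_ℂ + ⟪K₃ (K₃ v), v⟫_ℂ -
        ((ε ^ 2 : ℝ) : ℂ) * ((‖v‖ ^ 2 : ℝ) : ℂ) := by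
      have h1 : T v = K₁ (K₁ v) + K₂ (K₂ v) + K₃ (K₃ v) - ((ε ^ 2 : ℝ) : ℂ) • v := rfl
      rw [h1, inner_sub_left, inner_add_left, inner_add_left, inner_smul_left,
        Complex.conj_ofReal, inner_self_eq_norm_sq_to_K]
      push_cast
      rfl
    rw [this, hsq _ s₁, hsq _ s₂, hsq _ s₃, ← Complex.ofReal_mul, ← Complex.ofReal_add,
      ← Complex.ofReal_add, ← Complex.ofReal_sub, Complex.ofReal_re]
  obtain ⟨Q, sQ, hQQ, comm_Q, Q_pos, Q_neg⟩ := sT.exists_splitting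
  obtain ⟨E, sE, hEE, comm_E, E_pos, E_neg⟩ := s₃.exists_splitting
  have q₁ : Commute K₁ Q := comm_Q _ s₁ (comm_T _ (.refl _) c₁₂ c₁₃)
  have q₂ : Commute K₂ Q := comm_Q _ s₂ (comm_T _ c₁₂.symm (.refl _) c₂₃)
  have q₃ : Commute K₃ Q := comm_Q _ s₃ (comm_T _ c₁₃.symm c₂₃.symm (.refl _))
  have e₁ : Commute K₁ E := comm_E _ s₁ c₁₃
  have e₂ : Commute K₂ E := comm_E _ s₂ c₂₃
  have e₃ : Commute K₃ E := comm_E _ s₃ (.refl _)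
  have hEQ : Commute E Q := comm_Q _ sE (comm_T _ e₁.symm e₂.symm e₃.symm)
  have app : ∀ {A B : H →L[ℂ] H}, Commute A B → ∀ v, A (B v) = B (A v) := fun h v =>
    congrArg (fun A : H →L[ℂ] H => A v) h.eq
  have Q2 : ∀ a, Q (Q a) = Q a := fun a => congrArg (fun A : H →L[ℂ] H => A a) hQQ
  have E2 : ∀ a, E (E a) = E a := fun a => congrArg (fun A : H →L[ℂ] H => A a) hEE
  -- `κ` is injective on the range of `Q`
  have hinj : ∀ v, Q v = v → κ v = 0 → v = 0 := by
    intro v hv hκv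
    obtain ⟨z₁, z₂, z₃⟩ := hκ v hκv
    have hb : ∀ K A : H →L[ℂ] H, A v = 0 → ‖K v‖ ^ 2 ≤ ‖K - A‖ ^ 2 * ‖v‖ ^ 2 := by
      intro K A hA
      have : ‖K v‖ ≤ ‖K - A‖ * ‖v‖ := by
        simpa [hA] using (K - A).le_opNorm v
      calc ‖K v‖ ^ 2 ≤ (‖K - A‖ * ‖v‖) ^ 2 := by gcongr
        _ = _ := by ring
    have h0 := Q_pos v hv
    rw [hTv] at h0
    have b₁ := hb K₁ A₁ z₁
    have b₂ := hb K₂ A₂ z₂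
    have b₃ := hb K₃ A₃ z₃
    have n₁ := norm_nonneg (K₁ - A₁)
    have n₂ := norm_nonneg (K₂ - A₂)
    have n₃ := norm_nonneg (K₃ - A₃)
    have hs : ‖K₁ - A₁‖ ^ 2 + ‖K₂ - A₂‖ ^ 2 + ‖K₃ - A₃‖ ^ 2 < ε ^ 2 := by
      calc ‖K₁ - A₁‖ ^ 2 + ‖K₂ - A₂‖ ^ 2 + ‖K₃ - A₃‖ ^ 2
          ≤ (‖K₁ - A₁‖ + ‖K₂ - A₂‖ + ‖K₃ - A₃‖) ^ 2 := by
            nlinarith [mul_nonneg n₁ n₂, mul_nonneg n₁ n₃, mul_nonneg n₂ n₃]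
        _ < ε ^ 2 := by gcongr
    by_contra hne
    have hv2 : 0 < ‖v‖ ^ 2 := by positivity
    nlinarith [mul_pos (sub_pos.mpr hs) hv2]
  have hker := LinearMap.ker_ne_bot_of_finrank_lt
    (f := κ ∘ₗ Q.toLinearMap ∘ₗ (E.toLinearMap ∘ₗ x + (1 - E).toLinearMap ∘ₗ y)) hZY
  obtain ⟨c, hc, hc0⟩ := (Submodule.ne_bot_iff _).mp hker
  have hw : Q (E (x c) + (y c - E (y c))) = 0 := hinj _ (Q2 _) hc
  have hx : E (Q (x c)) = 0 := by
    have := congrArg E hw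
    simpa [app hEQ, E2] using this
  have hx' : Q (E (x c)) = 0 := by rw [← app hEQ, hx]
  have hy : E (Q (y c)) = Q (y c) := by
    rw [map_add, hx', zero_add, map_sub, sub_eq_zero] at hw
    rw [app hEQ, hw]
  have f₀ := hform c
  have f₁ : pauliForm A₁ A₂ A₃ (x c) (y c) ≤ pauliForm K₁ K₂ K₃ (x c) (y c) +
      (‖K₁ - A₁‖ + ‖K₂ - A₂‖ + ‖K₃ - A₃‖) * (‖x c‖ ^ 2 + ‖y c‖ ^ 2) := by
    have hs := pauliForm_sub A₁ A₂ A₃ K₁ K₂ K₃ (x c) (y c)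
    have := pauliForm_le_of_norm_le ((A₁ - K₁).le_opNorm (x c)) ((A₂ - K₂).le_opNorm (x c))
      ((A₃ - K₃).le_opNorm (x c)) ((A₃ - K₃).le_opNorm (y c)) (by positivity)
    rw [norm_sub_rev A₁, norm_sub_rev A₂, norm_sub_rev A₃] at this
    linarith
  have f₂ := pauliForm_eq_add sQ hQQ q₁ q₂ q₃ (x c) (y c)
  have f₃ : pauliForm K₁ K₂ K₃ (Q (x c)) (Q (y c)) ≤ 0 := by
    have hcross : ⟪(K₁ + Complex.I • K₂) (Q (x c)), Q (y c)⟫_ℂ = 0 := by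
      have hN : Commute (K₁ + Complex.I • K₂) E := e₁.add_left (e₂.smul_left _)
      rw [← hy, ← show ⟪E _, _⟫_ℂ = ⟪_, E _⟫_ℂ from sE.isSymmetric _ _, ← app hN, hx]
      simp
    have h1 := E_neg _ hx
    have h2 := E_pos _ hy
    unfold pauliForm
    rw [hcross, Complex.zero_re]
    linarith
  have hQ0 : ∀ v, Q (v - Q v) = 0 := fun v => by rw [map_sub, Q2, sub_self]
  have hεnn : 0 ≤ ε := by positivity
  have hsmall : ∀ v, Q v = 0 → ‖K₁ v‖ ≤ ε * ‖v‖ ∧ ‖K₂ v‖ ≤ ε * ‖v‖ ∧ ‖K₃ v‖ ≤ ε * ‖v‖ := by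
    intro v hv
    have h := Q_neg v hv
    rw [hTv, sub_nonpos, ← mul_pow] at h
    have n₁ := sq_nonneg (‖K₁ v‖)
    have n₂ := sq_nonneg (‖K₂ v‖)
    have n₃ := sq_nonneg (‖K₃ v‖)
    have hv0 : 0 ≤ ε * ‖v‖ := by positivity
    exact ⟨abs_le_of_sq_le_sq' (by linarith) hv0 |>.2, abs_le_of_sq_le_sq' (by linarith) hv0 |>.2,
      abs_le_of_sq_le_sq' (by linarith) hv0 |>.2⟩
  have hnorm : ∀ v, ‖v - Q v‖ ≤ ‖v‖ := by
    intro v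
    have h0 : ⟪Q v, v - Q v⟫_ℂ = 0 := by
      rw [show ⟪Q v, v - Q v⟫_ℂ = ⟪v, Q (v - Q v)⟫_ℂ from sQ.isSymmetric _ _, hQ0, inner_zero_right]
    have := norm_add_sq_eq_norm_sq_add_norm_sq_of_inner_eq_zero _ _ h0
    rw [add_sub_cancel] at this
    nlinarith [norm_nonneg v, norm_nonneg (v - Q v), mul_self_nonneg ‖Q v‖]
  have f₄ : pauliForm K₁ K₂ K₃ (x c - Q (x c)) (y c - Q (y c)) ≤
      3 * ε * (‖x c‖ ^ 2 + ‖y c‖ ^ 2) := by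
    obtain ⟨hx₁, hx₂, hx₃⟩ := hsmall _ (hQ0 (x c))
    have this := pauliForm_le_of_norm_le hx₁ hx₂ hx₃ (hsmall _ (hQ0 (y c))).2.2 (by positivity)
    refine this.trans ?_
    have h1 := hnorm (x c)
    have h2 := hnorm (y c)
    calc (ε + ε + ε) * (‖x c - Q (x c)‖ ^ 2 + ‖y c - Q (y c)‖ ^ 2)
        ≤ (ε + ε + ε) * (‖x c‖ ^ 2 + ‖y c‖ ^ 2) := by gcongr
      _ = _ := by ring
  have hpos : 0 < ‖x c‖ ^ 2 + ‖y c‖ ^ 2 := by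
    rcases hxy c hc0 with h | h
    · have := norm_pos_iff.mpr h
      positivity
    · have := norm_pos_iff.mpr h
      positivity
  nlinarith [mul_pos (sub_pos.mpr hlt) hpos]

end PauliForm

section OrthogonalSums

variable {H ι : Type*} [NormedAddCommGroup H] [InnerProductSpace ℂ H] [Fintype ι]

theorem inner_map_sum_smul_sum_smul [DecidableEq ι] {T : H →L[ℂ] H} {u w : ι → H} {d : ι → ℂ}
    (h : ∀ a b, ⟪T (u a), w b⟫_ℂ = if a = b then d a else 0) (p q : ι → ℂ) :
    ⟪T (∑ a, p a • u a), ∑ a, q a • w a⟫_ℂ = ∑ a, starRingEnd ℂ (p a) * q a * d a := by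
  simp only [map_sum, map_smul, sum_inner, inner_sum, inner_smul_left, inner_smul_right, h,
    mul_ite, mul_zero, Finset.sum_ite_eq', Finset.mem_univ, if_true]
  exact Finset.sum_congr rfl fun a _ => by ring

theorem norm_sq_sum_smul_of_pairwise_inner_eq_zero {b : ι → H}
    (hb : Pairwise fun i j => ⟪b i, b j⟫_ℂ = 0) (c : ι → ℂ) :
    ‖∑ i, c i • b i‖ ^ 2 = ∑ i, ‖c i‖ ^ 2 * ‖b i‖ ^ 2 := by
  classical
  have h := inner_map_sum_smul_sum_smul (T := .id ℂ H) (u := b) (w := b)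
    (d := fun i => ((‖b i‖ ^ 2 : ℝ) : ℂ)) (fun i j => by
      split_ifs with hij
      · subst hij
        rw [ContinuousLinearMap.id_apply, inner_self_eq_norm_sq_to_K]
        push_cast
        rfl
      · exact hb hij) c c
  rw [ContinuousLinearMap.id_apply, inner_self_eq_norm_sq_to_K] at h
  have : ((‖∑ i, c i • b i‖ ^ 2 : ℝ) : ℂ) = ((∑ i, ‖c i‖ ^ 2 * ‖b i‖ ^ 2 : ℝ) : ℂ) := by
    push_cast
    refine h.trans (Finset.sum_congr rfl fun i _ => ?_)
    rw [← Complex.normSq_eq_conj_mul_self, Complex.normSq_eq_norm_sq]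
    push_cast
    rfl
  exact_mod_cast this

theorem norm_sum_inner_smul_le {a b : ι → H} {α β : ℝ}
    (ha : Pairwise fun i j => ⟪a i, a j⟫_ℂ = 0) (hb : Pairwise fun i j => ⟪b i, b j⟫_ℂ = 0)
    (hα : ∀ i, ‖a i‖ ≤ α) (hβ : ∀ i, ‖b i‖ ≤ β) (hα0 : 0 ≤ α) (hβ0 : 0 ≤ β) (f : H) :
    ‖∑ i, ⟪a i, f⟫_ℂ • b i‖ ≤ α * β * ‖f‖ := by
  have bound : ∀ {e : ι → H} {γ : ℝ}, (Pairwise fun i j => ⟪e i, e j⟫_ℂ = 0) → (∀ i, ‖e i‖ ≤ γ) →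
      ‖∑ i, ⟪a i, f⟫_ℂ • e i‖ ^ 2 ≤ γ ^ 2 * ∑ i, ‖⟪a i, f⟫_ℂ‖ ^ 2 := by
    intro e γ he hγ
    rw [norm_sq_sum_smul_of_pairwise_inner_eq_zero he, Finset.mul_sum]
    refine Finset.sum_le_sum fun i _ => ?_
    rw [mul_comm]
    have := hγ i
    gcongr
  set S := ∑ i, ‖⟪a i, f⟫_ℂ‖ ^ 2 with hS
  have hS0 : 0 ≤ S := Finset.sum_nonneg fun i _ => sq_nonneg _
  have h1 := bound ha hα
  have h2 := bound hb hβ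
  have h3 : S ≤ ‖∑ i, ⟪a i, f⟫_ℂ • a i‖ * ‖f‖ := by
    have : ⟪∑ i, ⟪a i, f⟫_ℂ • a i, f⟫_ℂ = (S : ℂ) := by
      rw [sum_inner, hS]
      push_cast
      refine Finset.sum_congr rfl fun i _ => ?_
      rw [inner_smul_left, ← Complex.normSq_eq_conj_mul_self, Complex.normSq_eq_norm_sq]
      push_cast
      rfl
    calc S = ‖⟪∑ i, ⟪a i, f⟫_ℂ • a i, f⟫_ℂ‖ := by
          rw [this, Complex.norm_real, Real.norm_of_nonneg hS0]
      _ ≤ _ := norm_inner_le_norm _ _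
  have h4 : S ≤ α ^ 2 * ‖f‖ ^ 2 := by
    have : S ^ 2 ≤ α ^ 2 * S * ‖f‖ ^ 2 := by
      calc S ^ 2 ≤ (‖∑ i, ⟪a i, f⟫_ℂ • a i‖ * ‖f‖) ^ 2 := by gcongr
        _ = ‖∑ i, ⟪a i, f⟫_ℂ • a i‖ ^ 2 * ‖f‖ ^ 2 := by ring
        _ ≤ _ := by gcongr
    rcases hS0.eq_or_lt with h | h
    · rw [← h]
      positivity
    · refine le_of_mul_le_mul_right ?_ h
      linarith
  refine (abs_le_of_sq_le_sq' ?_ (by positivity)).2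
  calc ‖∑ i, ⟪a i, f⟫_ℂ • b i‖ ^ 2 ≤ β ^ 2 * S := h2
    _ ≤ β ^ 2 * (α ^ 2 * ‖f‖ ^ 2) := by gcongr
    _ = _ := by ring

variable [CompleteSpace H] {v : ι → H} {P : H →L[ℂ] H}

/-- An operator acting almost like a weighted permutation of an orthonormal family almost commutes
with the projection onto the span of the family. -/
theorem norm_commutator_le_of_orthonormal (hv : Orthonormal ℂ v)
    (hP : ∀ f, P f = ∑ a, ⟪v a, f⟫_ℂ • v a) (N : H →L[ℂ] H) (σ : Equiv.Perm ι) (ρ : ι → ℝ) {ε : ℝ}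
    (hε : 0 ≤ ε)
    (ho : Pairwise fun a b => ⟪N (v a) - (ρ a : ℂ) • v (σ a), N (v b) - (ρ b : ℂ) • v (σ b)⟫_ℂ = 0)
    (ho' : Pairwise fun a b => ⟪N.adjoint (v (σ a)) - (ρ a : ℂ) • v a,
      N.adjoint (v (σ b)) - (ρ b : ℂ) • v b⟫_ℂ = 0)
    (hn : ∀ a, ‖N (v a) - (ρ a : ℂ) • v (σ a)‖ ≤ ε)
    (hn' : ∀ a, ‖N.adjoint (v (σ a)) - (ρ a : ℂ) • v a‖ ≤ ε) :
    ‖P * N - N * P‖ ≤ 2 * ε := by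
  refine ContinuousLinearMap.opNorm_le_bound _ (by positivity) fun f => ?_
  have hvσ : Orthonormal ℂ (v ∘ σ) := hv.comp _ σ.injective
  have key : (P * N - N * P) f =
      ∑ a, ⟪N.adjoint (v (σ a)) - (ρ a : ℂ) • v a, f⟫_ℂ • v (σ a) -
      ∑ a, ⟪v a, f⟫_ℂ • (N (v a) - (ρ a : ℂ) • v (σ a)) := by
    have h1 : P (N f) = ∑ a, ⟪v (σ a), N f⟫_ℂ • v (σ a) := by
      rw [hP, ← Equiv.sum_comp σ]
    have h2 : N (P f) = ∑ a, ⟪v a, f⟫_ℂ • N (v a) := by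
      rw [hP, map_sum]
      simp only [map_smul]
    have h0 : (P * N - N * P) f = P (N f) - N (P f) := rfl
    rw [h0, h1, h2, ← Finset.sum_sub_distrib, ← Finset.sum_sub_distrib]
    refine Finset.sum_congr rfl fun a _ => ?_
    rw [inner_sub_left, ContinuousLinearMap.adjoint_inner_left, inner_smul_left,
      Complex.conj_ofReal]
    module
  have b1 := norm_sum_inner_smul_le (b := v ∘ σ) (β := 1) ho' hvσ.2 hn' (fun a => (hvσ.1 a).le)
    hε zero_le_one f
  have b2 := norm_sum_inner_smul_le (a := v) (α := 1) hv.2 ho (fun a => (hv.1 a).le) hn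
    zero_le_one hε f
  rw [key]
  refine (norm_sub_le _ _).trans ?_
  simp only [Function.comp_apply] at b1
  linarith

/-- A lower bound for the distance of a compressed triple to commuting triples, when on an
orthonormal basis of the compression space `A₃` is diagonal and `A₁ + i A₂` is a weighted
permutation. -/
theorem le_dist_commuting_of_orthonormal [DecidableEq ι] (hv : Orthonormal ℂ v)
    (hP : ∀ f, P f = ∑ a, ⟪v a, f⟫_ℂ • v a) {A₁ A₂ A₃ K₁ K₂ K₃ : H →L[ℂ] H} (σ : Equiv.Perm ι)
    (h r : ι → ℝ) (hA₃ : ∀ a b, ⟪A₃ (v a), v b⟫_ℂ = if a = b then (h a : ℂ) else 0)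
    (hN : ∀ a b, ⟪(A₁ + Complex.I • A₂) (v a), v (σ b)⟫_ℂ = if a = b then (r a : ℂ) else 0)
    {δ : ℝ} (hδ : 0 < δ) (a₀ : ι) (h₀ : δ ≤ h a₀) (h₀' : h (σ a₀) ≤ -δ) (r₀ : r a₀ = 0)
    (hphase : ∀ a, a ≠ a₀ → ∃ α β : ℝ, (α ≠ 0 ∨ β ≠ 0) ∧
      δ * (α ^ 2 + β ^ 2) ≤ h a * α ^ 2 - h (σ a) * β ^ 2 + 2 * (r a * (α * β)))
    (s₁ : IsSelfAdjoint K₁) (s₂ : IsSelfAdjoint K₂) (s₃ : IsSelfAdjoint K₃)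
    (c₁₂ : Commute K₁ K₂) (c₁₃ : Commute K₁ K₃) (c₂₃ : Commute K₂ K₃) :
    δ / 4 ≤ ‖K₁ - P * A₁ * P‖ + ‖K₂ - P * A₂ * P‖ + ‖K₃ - P * A₃ * P‖ := by
  choose! α β hαβ hform using hphase
  let p : (Option ι → ℂ) →ₗ[ℂ] ι → ℂ := LinearMap.pi fun a =>
    (if a = a₀ then (1 : ℂ) else α a) • LinearMap.proj (some a)
  let q : (Option ι → ℂ) →ₗ[ℂ] ι → ℂ := LinearMap.pi fun a =>
    if a = a₀ then LinearMap.proj none else (β a : ℂ) • LinearMap.proj (some a)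
  have hvσ : Orthonormal ℂ (v ∘ σ) := hv.comp _ σ.injective
  let x : (Option ι → ℂ) →ₗ[ℂ] H := Fintype.linearCombination ℂ v ∘ₗ p
  let y : (Option ι → ℂ) →ₗ[ℂ] H := Fintype.linearCombination ℂ (v ∘ σ) ∘ₗ q
  have hx : ∀ c, x c = ∑ a, p c a • v a := fun c => rfl
  have hy : ∀ c, y c = ∑ a, q c a • v (σ a) := fun c => rfl
  have hxn : ∀ c, ‖x c‖ ^ 2 = ∑ a, ‖p c a‖ ^ 2 := fun c => by
    rw [hx, norm_sq_sum_smul_of_pairwise_inner_eq_zero hv.2]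
    simp [hv.1]
  have hyn : ∀ c, ‖y c‖ ^ 2 = ∑ a, ‖q c a‖ ^ 2 := fun c => by
    rw [hy, norm_sq_sum_smul_of_pairwise_inner_eq_zero (b := fun a => v (σ a)) hvσ.2]
    simp [hv.1]
  have p₀ : ∀ c, p c a₀ = c (some a₀) := fun c => by simp [p]
  have q₀ : ∀ c, q c a₀ = c none := fun c => by simp [q]
  have p₁ : ∀ c a, a ≠ a₀ → p c a = α a * c (some a) := fun c a ha => by simp [p, ha]
  have q₁ : ∀ c a, a ≠ a₀ → q c a = β a * c (some a) := fun c a ha => by simp [q, ha]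
  have hPv : ∀ a, P (v a) = v a := fun a => by
    rw [hP]
    simp [orthonormal_iff_ite.mp hv]
  have hPsymm : ∀ f g, ⟪P f, g⟫_ℂ = ⟪f, P g⟫_ℂ := fun f g => by
    rw [hP, hP, sum_inner, inner_sum]
    refine Finset.sum_congr rfl fun a _ => ?_
    rw [inner_smul_left, inner_smul_right, inner_conj_symm, mul_comm]
  have hPx : ∀ c, P (x c) = x c := fun c => by simp only [hx, map_sum, map_smul, hPv]
  have hPy : ∀ c, P (y c) = y c := fun c => by simp only [hy, map_sum, map_smul, hPv]
  refine le_dist_commuting_of_pauliForm (Z := ι → ℂ) hδ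
    (LinearMap.pi fun a => (innerSL ℂ (v a)).toLinearMap) ?_ x y ?_ ?_ ?_ s₁ s₂ s₃ c₁₂ c₁₃ c₂₃
  · intro f hf
    have : P f = 0 := by
      rw [hP]
      refine Finset.sum_eq_zero fun a _ => ?_
      rw [show ⟪v a, f⟫_ℂ = 0 from congrFun hf a, zero_smul]
    simp [this]
  · simp
  · intro c hc
    by_contra! h0
    refine hc (funext fun o => ?_)
    have hp : ∀ a, p c a = 0 := by
      have := hxn c
      rw [h0.1, norm_zero, zero_pow two_ne_zero, eq_comm,
        Finset.sum_eq_zero_iff_of_nonneg fun _ _ => sq_nonneg _] at this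
      exact fun a => by simpa using this a (Finset.mem_univ a)
    have hq : ∀ a, q c a = 0 := by
      have := hyn c
      rw [h0.2, norm_zero, zero_pow two_ne_zero, eq_comm,
        Finset.sum_eq_zero_iff_of_nonneg fun _ _ => sq_nonneg _] at this
      exact fun a => by simpa using this a (Finset.mem_univ a)
    rcases o with _ | a
    · rw [← q₀ c, hq]
      rfl
    · by_cases ha : a = a₀
      · subst ha
        rw [← p₀ c, hp]
        rfl
      · have hpa := hp a
        have hqa := hq a
        rw [p₁ _ _ ha] at hpa
        rw [q₁ _ _ ha] at hqa
        rcases hαβ a ha with h1 | h1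
        · simpa [h1] using hpa
        · simpa [h1] using hqa
  · intro c
    have e : pauliForm (P * A₁ * P) (P * A₂ * P) (P * A₃ * P) (x c) (y c) =
        pauliForm A₁ A₂ A₃ (x c) (y c) := by
      have hN' : P * A₁ * P + Complex.I • (P * A₂ * P) = P * (A₁ + Complex.I • A₂) * P := by
        simp [mul_add, add_mul]
      unfold pauliForm
      rw [hN']
      simp only [mul_apply_eq_comp, hPsymm, hPx, hPy]
    have e₁ : ⟪A₃ (x c), x c⟫_ℂ = ∑ a, starRingEnd ℂ (p c a) * p c a * h a := by
      rw [hx]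
      exact inner_map_sum_smul_sum_smul hA₃ _ _
    have e₂ : ⟪A₃ (y c), y c⟫_ℂ = ∑ a, starRingEnd ℂ (q c a) * q c a * h (σ a) := by
      rw [hy]
      exact inner_map_sum_smul_sum_smul (fun a b => by simp [hA₃]) _ _
    have e₃ : ⟪(A₁ + Complex.I • A₂) (x c), y c⟫_ℂ =
        ∑ a, starRingEnd ℂ (p c a) * q c a * r a := by
      rw [hx, hy]
      exact inner_map_sum_smul_sum_smul hN _ _
    rw [e, pauliForm, e₁, e₂, e₃, hxn, hyn, ← Finset.sum_add_distrib, Finset.mul_sum,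
      Complex.re_sum, Complex.re_sum, Complex.re_sum, ← Finset.sum_sub_distrib, Finset.mul_sum,
      ← Finset.sum_add_distrib]
    refine Finset.sum_le_sum fun a _ => ?_
    have hre : ∀ (z w : ℂ) (t : ℝ),
        (starRingEnd ℂ z * w * t).re = (z.re * w.re + z.im * w.im) * t :=
      fun z w t => by simp
    simp only [hre, Complex.sq_norm, Complex.normSq_apply]
    by_cases ha : a = a₀
    · subst ha
      rw [r₀]
      nlinarith [mul_nonneg (sub_nonneg.mpr h₀) (mul_self_nonneg (p c a).re),
        mul_nonneg (sub_nonneg.mpr h₀) (mul_self_nonneg (p c a).im),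
        mul_nonneg (sub_nonneg.mpr h₀') (mul_self_nonneg (q c a).re),
        mul_nonneg (sub_nonneg.mpr h₀') (mul_self_nonneg (q c a).im)]
    · rw [p₁ _ _ ha, q₁ _ _ ha]
      simp only [Complex.re_ofReal_mul, Complex.im_ofReal_mul]
      have hz : 0 ≤ (c (some a)).re ^ 2 + (c (some a)).im ^ 2 := by positivity
      have := mul_le_mul_of_nonneg_right (hform a ha) hz
      linarith

end OrthogonalSums

section CommutingDist

variable {H : Type*} [NormedAddCommGroup H] [InnerProductSpace ℂ H] [CompleteSpace H]

/-- The distance of a triple of operators to the commuting self-adjoint triples. -/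
def commutingDist (A₁ A₂ A₃ : H →L[ℂ] H) : ℝ :=
  sInf { d : ℝ | ∃ K₁ K₂ K₃ : H →L[ℂ] H,
    IsSelfAdjoint K₁ ∧ IsSelfAdjoint K₂ ∧ IsSelfAdjoint K₃ ∧
    Commute K₁ K₂ ∧ Commute K₁ K₃ ∧ Commute K₂ K₃ ∧
    d = ‖K₁ - A₁‖ + ‖K₂ - A₂‖ + ‖K₃ - A₃‖ }

theorem le_commutingDist {A₁ A₂ A₃ : H →L[ℂ] H} {c : ℝ}
    (h : ∀ K₁ K₂ K₃ : H →L[ℂ] H, IsSelfAdjoint K₁ → IsSelfAdjoint K₂ → IsSelfAdjoint K₃ →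
      Commute K₁ K₂ → Commute K₁ K₃ → Commute K₂ K₃ →
      c ≤ ‖K₁ - A₁‖ + ‖K₂ - A₂‖ + ‖K₃ - A₃‖) : c ≤ commutingDist A₁ A₂ A₃ := by
  refine le_csInf ⟨_, 0, 0, 0, .zero _, .zero _, .zero _, .refl _, .refl _, .refl _, rfl⟩ ?_
  rintro d ⟨K₁, K₂, K₃, s₁, s₂, s₃, c₁₂, c₁₃, c₂₃, rfl⟩
  exact h K₁ K₂ K₃ s₁ s₂ s₃ c₁₂ c₁₃ c₂₃

theorem commutingDist_le {A₁ A₂ A₃ K₁ K₂ K₃ : H →L[ℂ] H} (s₁ : IsSelfAdjoint K₁)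
    (s₂ : IsSelfAdjoint K₂) (s₃ : IsSelfAdjoint K₃) (c₁₂ : Commute K₁ K₂) (c₁₃ : Commute K₁ K₃)
    (c₂₃ : Commute K₂ K₃) :
    commutingDist A₁ A₂ A₃ ≤ ‖K₁ - A₁‖ + ‖K₂ - A₂‖ + ‖K₃ - A₃‖ := by
  refine csInf_le ⟨0, ?_⟩ ⟨K₁, K₂, K₃, s₁, s₂, s₃, c₁₂, c₁₃, c₂₃, rfl⟩
  rintro d ⟨_, _, _, -, -, -, -, -, -, rfl⟩
  positivity

theorem commutingDist_nonneg (A₁ A₂ A₃ : H →L[ℂ] H) : 0 ≤ commutingDist A₁ A₂ A₃ :=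
  le_commutingDist fun _ _ _ _ _ _ _ _ _ => by positivity

theorem commutingDist_le_norm (A₁ A₂ A₃ : H →L[ℂ] H) :
    commutingDist A₁ A₂ A₃ ≤ ‖A₁‖ + ‖A₂‖ + ‖A₃‖ := by
  simpa using commutingDist_le (A₁ := A₁) (A₂ := A₂) (A₃ := A₃) (.zero _) (.zero _) (.zero _)
    (.refl (0 : H →L[ℂ] H)) (.refl _) (.refl _)

theorem commutingDist_smul {t : ℝ} (ht : 0 < t) (A₁ A₂ A₃ : H →L[ℂ] H) :
    commutingDist ((t : ℂ) • A₁) ((t : ℂ) • A₂) ((t : ℂ) • A₃) = t * commutingDist A₁ A₂ A₃ := by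
  have key : ∀ {t : ℝ}, 0 < t → ∀ A₁ A₂ A₃ : H →L[ℂ] H,
      commutingDist ((t : ℂ) • A₁) ((t : ℂ) • A₂) ((t : ℂ) • A₃) ≤ t * commutingDist A₁ A₂ A₃ := by
    intro t ht A₁ A₂ A₃
    rw [← div_le_iff₀' ht]
    refine le_commutingDist fun K₁ K₂ K₃ s₁ s₂ s₃ c₁₂ c₁₃ c₂₃ => ?_
    have hs : ∀ {K : H →L[ℂ] H}, IsSelfAdjoint K → IsSelfAdjoint ((t : ℂ) • K) :=
      fun hK => IsSelfAdjoint.smul (Complex.conj_ofReal _) hK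
    have hc : ∀ {K L : H →L[ℂ] H}, Commute K L → Commute ((t : ℂ) • K) ((t : ℂ) • L) :=
      fun h => (h.smul_left _).smul_right _
    rw [div_le_iff₀' ht]
    refine (commutingDist_le (hs s₁) (hs s₂) (hs s₃) (hc c₁₂) (hc c₁₃) (hc c₂₃)).trans_eq ?_
    simp only [← smul_sub, norm_smul, Complex.norm_real, Real.norm_of_nonneg ht.le]
    ring
  refine le_antisymm (key ht _ _ _) ?_
  have ht' : (t : ℂ) ≠ 0 := by exact_mod_cast ht.ne'
  have := key (inv_pos.mpr ht) ((t : ℂ) • A₁) ((t : ℂ) • A₂) ((t : ℂ) • A₃)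
  simp only [Complex.ofReal_inv, smul_smul, inv_mul_cancel₀ ht', one_smul] at this
  rwa [← div_eq_inv_mul, le_div_iff₀' ht] at this

theorem IsSelfAdjoint.norm_le_one_of_isIdempotentElem {P : H →L[ℂ] H} (hP : IsSelfAdjoint P)
    (hPP : IsIdempotentElem P) : ‖P‖ ≤ 1 := by
  have h : ‖P * P‖ = ‖P‖ * ‖P‖ := by
    simpa [hP.star_eq] using CStarRing.norm_star_mul_self (x := P)
  rw [hPP.eq] at h
  nlinarith [norm_nonneg P]

/-- After passing to a subsequence of the projections and rescaling, distances bounded away from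
zero may be assumed to converge to one. -/
theorem exists_subseq_tendsto_commutingDist {H₁ H₂ H₃ : H →L[ℂ] H} {P : ℕ → H →L[ℂ] H}
    (hP : ∀ k, IsSelfAdjoint (P k)) (hPP : ∀ k, IsIdempotentElem (P k)) {c : ℝ} (hc : 0 < c)
    (h : ∀ᶠ k in atTop, c ≤ commutingDist (P k * H₁ * P k) (P k * H₂ * P k) (P k * H₃ * P k)) :
    ∃ t : ℝ, 0 < t ∧ ∃ φ : ℕ → ℕ, StrictMono φ ∧ Tendsto (fun k =>
      commutingDist (P (φ k) * ((t : ℂ) • H₁) * P (φ k)) (P (φ k) * ((t : ℂ) • H₂) * P (φ k))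
        (P (φ k) * ((t : ℂ) • H₃) * P (φ k))) atTop (𝓝 1) := by
  have hle : ∀ k (A : H →L[ℂ] H), ‖P k * A * P k‖ ≤ ‖A‖ := fun k A => by
    have h1 := (hP k).norm_le_one_of_isIdempotentElem (hPP k)
    calc ‖P k * A * P k‖ ≤ ‖P k‖ * ‖A‖ * ‖P k‖ :=
          (norm_mul_le _ _).trans (by gcongr; exact norm_mul_le _ _)
      _ ≤ 1 * ‖A‖ * 1 := by gcongr
      _ = ‖A‖ := by ring
  obtain ⟨l, -, φ, hφ, hl⟩ := tendsto_subseq_of_bounded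
    (Metric.isBounded_Icc (0 : ℝ) (‖H₁‖ + ‖H₂‖ + ‖H₃‖))
    (x := fun k => commutingDist (P k * H₁ * P k) (P k * H₂ * P k) (P k * H₃ * P k)) fun k =>
      ⟨commutingDist_nonneg _ _ _,
        (commutingDist_le_norm _ _ _).trans (by gcongr <;> exact hle _ _)⟩
  have hl0 : 0 < l := hc.trans_le (ge_of_tendsto hl (hφ.tendsto_atTop.eventually h))
  refine ⟨l⁻¹, inv_pos.mpr hl0, φ, hφ, ?_⟩
  have := hl.const_mul l⁻¹
  rw [inv_mul_cancel₀ hl0.ne'] at this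
  refine this.congr fun k => ?_
  simp only [Function.comp_apply, mul_smul_comm, smul_mul_assoc,
    commutingDist_smul (inv_pos.mpr hl0)]

end CommutingDist

section WeightedComp

variable {ι : Type*}

/-- The weighted composition operator `f ↦ (i ↦ w i * f (τ i))` on `ℓ²`, for weights bounded by
one. -/
def weightedComp (w : ι → ℝ) (hw : ∀ i, |w i| ≤ 1) (τ : Equiv.Perm ι) :
    lp (fun _ : ι => ℂ) 2 →L[ℂ] lp (fun _ : ι => ℂ) 2 :=
  have hle : ∀ (f : lp (fun _ : ι => ℂ) 2) i, ‖(w i : ℂ) * f (τ i)‖ ^ (2 : ENNReal).toReal ≤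
      ‖f (τ i)‖ ^ (2 : ENNReal).toReal := fun f i => by
    rw [norm_mul, Complex.norm_real, Real.norm_eq_abs]
    exact Real.rpow_le_rpow (by positivity) (mul_le_of_le_one_left (norm_nonneg _) (hw i))
      (by simp)
  have hs : ∀ f : lp (fun _ : ι => ℂ) 2, Summable fun i => ‖f (τ i)‖ ^ (2 : ENNReal).toReal :=
    fun f => τ.summable_iff.mpr ((lp.memℓp f).summable (by simp))
  have hmem : ∀ f : lp (fun _ : ι => ℂ) 2, Memℓp (fun i => (w i : ℂ) * f (τ i)) 2 := fun f =>
    memℓp_gen ((hs f).of_nonneg_of_le (fun i => by positivity) (hle f))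
  LinearMap.mkContinuous
    { toFun := fun f => ⟨fun i => (w i : ℂ) * f (τ i), hmem f⟩
      map_add' := fun f g => lp.ext (funext fun i => mul_add _ _ _)
      map_smul' := fun c f => lp.ext (funext fun i => mul_left_comm _ _ _) } 1
    fun f => by
      rw [one_mul]
      refine lp.norm_le_of_tsum_le (by simp) (norm_nonneg _) ?_
      rw [lp.norm_rpow_eq_tsum (by simp) f, ← τ.tsum_eq fun i => ‖f i‖ ^ (2 : ENNReal).toReal]
      exact ((hs f).of_nonneg_of_le (fun i => by positivity) (hle f)).tsum_le_tsum (hle f) (hs f)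

variable {w w' : ι → ℝ} {hw : ∀ i, |w i| ≤ 1} {hw' : ∀ i, |w' i| ≤ 1} {τ τ' : Equiv.Perm ι}

@[simp]
theorem weightedComp_apply (f : lp (fun _ : ι => ℂ) 2) (i : ι) :
    weightedComp w hw τ f i = w i * f (τ i) := rfl

theorem weightedComp_commute (h : ∀ i, w (τ' i) = w i) (h' : ∀ i, w' (τ i) = w' i)
    (hτ : ∀ i, τ' (τ i) = τ (τ' i)) : Commute (weightedComp w hw τ) (weightedComp w' hw' τ') := by
  refine ContinuousLinearMap.ext fun f => lp.ext (funext fun i => ?_)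
  simp only [mul_apply_eq_comp, weightedComp_apply, h, h', hτ]
  ring

theorem adjoint_weightedComp (h : ∀ i, w (τ i) = w i) :
    (weightedComp w hw τ).adjoint = weightedComp w hw τ.symm := by
  symm
  rw [ContinuousLinearMap.eq_adjoint_iff]
  intro f g
  rw [lp.inner_eq_tsum, lp.inner_eq_tsum, ← τ.tsum_eq]
  refine tsum_congr fun i => ?_
  simp only [weightedComp_apply, h, Equiv.symm_apply_apply, RCLike.inner_apply, map_mul,
    Complex.conj_ofReal]
  ring

theorem weightedComp_single [DecidableEq ι] (h : ∀ i, w (τ i) = w i) (i : ι) :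
    weightedComp w hw τ (lp.single 2 i 1) = (w i : ℂ) • lp.single 2 (τ.symm i) (1 : ℂ) := by
  refine lp.ext (funext fun j => ?_)
  simp only [weightedComp_apply, lp.coeFn_smul, Pi.smul_apply, lp.single_apply, Pi.single_apply,
    smul_eq_mul, Equiv.eq_symm_apply]
  by_cases hj : τ j = i
  · subst hj
    simp [h]
  · simp [hj]

end WeightedComp

section Commutator

variable {A : Type*} [NormedRing A] [StarRing A] [CStarRing A] [NormedAlgebra ℂ A] [StarModule ℂ A]

open ComplexStarModule in
theorem IsSelfAdjoint.norm_commutator_realPart_le {P : A} (hP : IsSelfAdjoint P) (N : A) :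
    ‖P * (ℜ N : A) - (ℜ N : A) * P‖ ≤ ‖P * N - N * P‖ := by
  have h : P * star N - star N * P = -star (P * N - N * P) := by
    simp [hP.star_eq]
  have e : P * (ℜ N : A) - (ℜ N : A) * P =
      (2 : ℝ)⁻¹ • ((P * N - N * P) + (P * star N - star N * P)) := by
    rw [realPart_apply_coe, mul_smul_comm, smul_mul_assoc, ← smul_sub]
    congr 1
    noncomm_ring
  rw [e, h, norm_smul]
  have := norm_add_le (P * N - N * P) (-star (P * N - N * P))
  rw [norm_neg, norm_star] at this
  rw [Real.norm_of_nonneg (by norm_num)]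
  linarith

open ComplexStarModule in
theorem IsSelfAdjoint.norm_commutator_imaginaryPart_le {P : A} (hP : IsSelfAdjoint P) (N : A) :
    ‖P * (ℑ N : A) - (ℑ N : A) * P‖ ≤ ‖P * N - N * P‖ := by
  have h : P * (Complex.I • N) - (Complex.I • N) * P = Complex.I • (P * N - N * P) := by
    rw [mul_smul_comm, smul_mul_assoc, ← smul_sub]
  have := hP.norm_commutator_realPart_le (Complex.I • N)
  rw [h, norm_smul, Complex.norm_I, one_mul, realPart_I_smul, NegMemClass.coe_neg,
    mul_neg, neg_mul, ← neg_sub', norm_neg] at this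
  exact this

end Commutator

section Model

/-- The diagonal entry of the third operator at height `s` of the `j`-th block. -/
def height (j s : ℕ) : ℝ := max (-1) (min 1 (6 * (s / (j + 1)) - 3))

/-- The weight of the shift at height `s` of the `j`-th block. -/
def coupling (j s : ℕ) : ℝ := max 0 (min 1 (min (3 * (s / (j + 1))) (3 - 3 * (s / (j + 1)))))

theorem abs_height_le (j s : ℕ) : |height j s| ≤ 1 :=
  abs_le.mpr ⟨le_max_left _ _, max_le (by norm_num) (min_le_left _ _)⟩

theorem coupling_nonneg (j s : ℕ) : 0 ≤ coupling j s := le_max_left _ _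

theorem coupling_le_one (j s : ℕ) : coupling j s ≤ 1 := max_le zero_le_one (min_le_left _ _)

theorem abs_coupling_le (j s : ℕ) : |coupling j s| ≤ 1 := by
  rw [abs_of_nonneg (coupling_nonneg j s)]
  exact coupling_le_one j s

theorem height_zero (j : ℕ) : height j 0 = -1 := by
  norm_num [height]

theorem height_self (j : ℕ) : height j (j + 1) = 1 := by
  have : ((j + 1 : ℕ) : ℝ) / (j + 1) = 1 := by
    push_cast
    exact div_self (by positivity)
  rw [height, this]
  norm_num

theorem coupling_zero (j : ℕ) : coupling j 0 = 0 := by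
  norm_num [coupling]

theorem coupling_self (j : ℕ) : coupling j (j + 1) = 0 := by
  have : ((j + 1 : ℕ) : ℝ) / (j + 1) = 1 := by
    push_cast
    exact div_self (by positivity)
  rw [coupling, this]
  norm_num

theorem abs_height_succ_sub_le (j s : ℕ) : |height j (s + 1) - height j s| ≤ 6 / (j + 1) := by
  have h : ((s + 1 : ℕ) : ℝ) / (j + 1) = s / (j + 1) + 1 / (j + 1) := by
    push_cast
    ring
  have h' : (6 : ℝ) / (j + 1) = 6 * (1 / (j + 1)) := by ring
  have h0 : (0 : ℝ) < 1 / (j + 1) := by positivity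
  unfold height
  rw [h, h']
  generalize (s : ℝ) / (j + 1) = t at *
  generalize (1 : ℝ) / (j + 1) = u at *
  rw [abs_le]
  constructor <;> grind

theorem abs_coupling_succ_sub_le (j s : ℕ) : |coupling j (s + 1) - coupling j s| ≤ 3 / (j + 1) := by
  have h : ((s + 1 : ℕ) : ℝ) / (j + 1) = s / (j + 1) + 1 / (j + 1) := by
    push_cast
    ring
  have h' : (3 : ℝ) / (j + 1) = 3 * (1 / (j + 1)) := by ring
  have h0 : (0 : ℝ) < 1 / (j + 1) := by positivity
  unfold coupling
  rw [h, h']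
  generalize (s : ℝ) / (j + 1) = t at *
  generalize (1 : ℝ) / (j + 1) = u at *
  rw [abs_le]
  constructor <;> grind

theorem exists_phase {j s : ℕ} {h₁ h₂ r : ℝ} (e₁ : |h₁ - height j s| ≤ 1 / 8)
    (e₂ : |h₂ - height j s| ≤ 1 / 8) (e₃ : |r - coupling j s| ≤ 1 / 8) :
    ∃ α β : ℝ, (α ≠ 0 ∨ β ≠ 0) ∧
      1 / 4 * (α ^ 2 + β ^ 2) ≤ h₁ * α ^ 2 - h₂ * β ^ 2 + 2 * (r * (α * β)) := by
  rw [abs_le] at e₁ e₂ e₃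
  rcases le_total (height j s) (-(1 / 2)) with h | h
  · exact ⟨0, 1, by simp, by linarith⟩
  rcases le_total (1 / 2) (height j s) with h' | h'
  · exact ⟨1, 0, by simp, by linarith⟩
  have : coupling j s = 1 := by
    unfold coupling
    unfold height at h h'
    generalize (s : ℝ) / (j + 1) = t at *
    grind
  exact ⟨1, 1, by simp, by linarith⟩

/-- The cyclic shift of the first `L` natural numbers. -/
def rotate (L : ℕ) : Equiv.Perm ℕ := (finRotate L).extendDomain Fin.equivSubtype

theorem rotate_coe {L : ℕ} (m : Fin L) : rotate L m = finRotate L m :=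
  (finRotate L).extendDomain_apply_image Fin.equivSubtype m

theorem rotate_of_le {L m : ℕ} (h : L ≤ m) : rotate L m = m :=
  (finRotate L).extendDomain_apply_not_subtype _ (not_lt.mpr h)

theorem rotate_lt_iff {L B : ℕ} (h : L ≤ B) (m : ℕ) : rotate L m < B ↔ m < B := by
  rcases lt_or_ge m L with hm | hm
  · have h1 := (finRotate L ⟨m, hm⟩).isLt
    rw [← rotate_coe] at h1
    exact ⟨fun _ => hm.trans_le h, fun _ => h1.trans_le h⟩
  · rw [rotate_of_le hm]

/-- The permutation of the sites `(j, m, s)` that rotates `m` among the first `(j + 1) ^ 2 + 1`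
values. -/
def siteRotate : Equiv.Perm (ℕ × ℕ × ℕ) :=
  Equiv.prodCongrRight fun j => Equiv.prodCongr (rotate ((j + 1) ^ 2 + 1)) (Equiv.refl ℕ)

theorem siteRotate_apply (j m s : ℕ) :
    siteRotate (j, m, s) = (j, rotate ((j + 1) ^ 2 + 1) m, s) := rfl

theorem siteRotate_symm_apply (j m s : ℕ) :
    siteRotate.symm (j, m, s) = (j, (rotate ((j + 1) ^ 2 + 1)).symm m, s) := rfl

/-- The Hilbert space of the model. -/
abbrev SiteSpace : Type := lp (fun _ : ℕ × ℕ × ℕ => ℂ) 2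

/-- Multiplication by the height. -/
def heightOp : SiteSpace →L[ℂ] SiteSpace :=
  weightedComp (fun i => height i.1 i.2.2) (fun _ => abs_height_le _ _) (Equiv.refl _)

/-- The weighted rotation. -/
def shiftOp : SiteSpace →L[ℂ] SiteSpace :=
  weightedComp (fun i => coupling i.1 i.2.2) (fun _ => abs_coupling_le _ _) siteRotate.symm

theorem adjoint_heightOp : heightOp.adjoint = heightOp :=
  adjoint_weightedComp fun _ => rfl

theorem adjoint_shiftOp : shiftOp.adjoint =
    weightedComp (fun i => coupling i.1 i.2.2) (fun _ => abs_coupling_le _ _) siteRotate :=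
  adjoint_weightedComp fun _ => rfl

theorem commute_heightOp_shiftOp : Commute heightOp shiftOp :=
  weightedComp_commute (fun _ => rfl) (fun _ => rfl) fun _ => rfl

theorem isStarNormal_shiftOp : IsStarNormal shiftOp := by
  constructor
  rw [ContinuousLinearMap.star_eq_adjoint, adjoint_shiftOp]
  exact weightedComp_commute (fun _ => rfl) (fun _ => rfl) fun i => by simp

/-- A vector supported at two neighbouring heights. -/
def pairVec (j m s : ℕ) (c d : ℝ) : SiteSpace :=
  (c : ℂ) • lp.single 2 (j, m, s) 1 + (d : ℂ) • lp.single 2 (j, m, s + 1) 1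

theorem pairVec_one_zero (j m s : ℕ) : pairVec j m s 1 0 = lp.single 2 (j, m, s) 1 := by
  simp [pairVec]

theorem heightOp_pairVec (j m s : ℕ) (c d : ℝ) :
    heightOp (pairVec j m s c d) =
      pairVec j m s (height j s * c) (height j (s + 1) * d) := by
  simp only [pairVec, heightOp, map_add, map_smul]
  rw [weightedComp_single fun _ => rfl, weightedComp_single fun _ => rfl]
  simp only [smul_smul, Equiv.refl_symm, Equiv.refl_apply, Complex.ofReal_mul, mul_comm]

theorem shiftOp_pairVec (j m s : ℕ) (c d : ℝ) :
    shiftOp (pairVec j m s c d) = pairVec j (rotate ((j + 1) ^ 2 + 1) m) s (coupling j s * c)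
      (coupling j (s + 1) * d) := by
  simp only [pairVec, shiftOp, map_add, map_smul]
  rw [weightedComp_single fun _ => rfl, weightedComp_single fun _ => rfl]
  simp only [smul_smul, Equiv.symm_symm, siteRotate_apply, Complex.ofReal_mul, mul_comm]

theorem adjoint_shiftOp_pairVec (j m s : ℕ) (c d : ℝ) :
    shiftOp.adjoint (pairVec j (rotate ((j + 1) ^ 2 + 1) m) s c d) =
      pairVec j m s (coupling j s * c) (coupling j (s + 1) * d) := by
  rw [adjoint_shiftOp]
  simp only [pairVec, map_add, map_smul]
  rw [weightedComp_single fun _ => rfl, weightedComp_single fun _ => rfl]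
  simp only [smul_smul, siteRotate_symm_apply, Equiv.symm_apply_apply, Complex.ofReal_mul, mul_comm]

theorem pairVec_sub_smul (j m s : ℕ) (c d c' d' ρ : ℝ) :
    pairVec j m s c d - (ρ : ℂ) • pairVec j m s c' d' =
      pairVec j m s (c - ρ * c') (d - ρ * d') := by
  simp only [pairVec]
  push_cast
  module

theorem norm_pairVec_le (j m s : ℕ) (c d : ℝ) : ‖pairVec j m s c d‖ ≤ |c| + |d| := by
  refine (norm_add_le _ _).trans_eq ?_
  simp only [norm_smul, Complex.norm_real, Real.norm_eq_abs,
    lp.norm_single (by norm_num : 0 < (2 : ENNReal)), norm_one, mul_one]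

theorem inner_single_single (i i' : ℕ × ℕ × ℕ) :
    ⟪(lp.single 2 i 1 : SiteSpace), lp.single 2 i' 1⟫_ℂ = if i = i' then 1 else 0 := by
  rw [lp.inner_single_left]
  simp [Pi.single_apply]

theorem inner_pairVec (j m s : ℕ) (c d c' d' : ℝ) :
    ⟪pairVec j m s c d, pairVec j m s c' d'⟫_ℂ = ((c * c' + d * d' : ℝ) : ℂ) := by
  simp only [pairVec, inner_add_left, inner_add_right, inner_smul_left, inner_smul_right,
    inner_single_single]
  simp
  ring

theorem inner_pairVec_of_ne {j m s j' m' s' : ℕ} (h : (j, m) ≠ (j', m')) (c d c' d' : ℝ) :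
    ⟪pairVec j m s c d, pairVec j' m' s' c' d'⟫_ℂ = 0 := by
  have h1 : ∀ s s' : ℕ, (j, m, s) ≠ (j', m', s') := fun s s' h0 => h (by simp_all)
  simp only [pairVec, inner_add_left, inner_add_right, inner_smul_left, inner_smul_right,
    inner_single_single, if_neg (h1 _ _)]
  simp

end Model

section Projections

open Real

/-- The finite set of sites in the first `n` blocks that are used in full. -/
def siteBox (n : ℕ) : Finset (ℕ × ℕ × ℕ) :=
  Finset.range n ×ˢ Finset.range (n ^ 2 + n + 2) ×ˢ Finset.range (n ^ 2 + n + 2)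

theorem mem_siteBox {n j m s : ℕ} :
    (j, m, s) ∈ siteBox n ↔ j < n ∧ m < n ^ 2 + n + 2 ∧ s < n ^ 2 + n + 2 := by
  simp [siteBox]

theorem siteRotate_mem_siteBox_iff (n : ℕ) (i : ℕ × ℕ × ℕ) :
    siteRotate i ∈ siteBox n ↔ i ∈ siteBox n := by
  obtain ⟨j, m, s⟩ := i
  rw [siteRotate_apply, mem_siteBox, mem_siteBox]
  refine and_congr_right fun hj => and_congr_left fun _ => rotate_lt_iff ?_ m
  have : (j + 1) ^ 2 ≤ n ^ 2 := Nat.pow_le_pow_left hj 2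
  lia

/-- The angle describing the position of the `m`-th wave of the `n`-th block. -/
def waveAngle (n m : ℕ) : ℝ := π / 2 * ((m % (n + 1) : ℕ) / (n + 1))

/-- The `m`-th wave of the `n`-th block, climbing slowly as `m` grows. -/
def wave (n m : ℕ) : SiteSpace :=
  pairVec n m (m / (n + 1)) (cos (waveAngle n m)) (sin (waveAngle n m))

theorem wave_zero (n : ℕ) : wave n 0 = pairVec n 0 0 1 0 := by
  simp [wave, waveAngle]

theorem wave_sq (n : ℕ) : wave n ((n + 1) ^ 2) = pairVec n ((n + 1) ^ 2) (n + 1) 1 0 := by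
  have h1 : (n + 1) ^ 2 / (n + 1) = n + 1 := by
    rw [pow_two, Nat.mul_div_cancel _ n.succ_pos]
  have h2 : (n + 1) ^ 2 % (n + 1) = 0 := by
    rw [pow_two, Nat.mul_mod_left]
  simp [wave, waveAngle, h1, h2]

theorem exists_wave_succ (n m : ℕ) : ∃ θ : ℝ,
    wave n (m + 1) = pairVec n (m + 1) (m / (n + 1)) (cos θ) (sin θ) ∧
      |θ - waveAngle n m| ≤ 2 / (n + 1) := by
  have hn : (0 : ℝ) < n + 1 := by positivity
  have hmod := Nat.mod_lt m n.succ_pos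
  have hdm := Nat.div_add_mod m (n + 1)
  refine ⟨waveAngle n m + π / 2 * (1 / (n + 1)), ?_, ?_⟩
  · rcases (Nat.succ_le_of_lt hmod).lt_or_eq with h | h
    · obtain ⟨h1, h2⟩ : (m + 1) / (n + 1) = m / (n + 1) ∧ (m + 1) % (n + 1) = m % (n + 1) + 1 :=
        (Nat.div_mod_unique n.succ_pos).mpr ⟨by lia, h⟩
      have h3 : waveAngle n (m + 1) = waveAngle n m + π / 2 * (1 / (n + 1)) := by
        simp only [waveAngle, h2]
        push_cast
        ring
      rw [wave, h1, h3]
    · have h0 : m + 1 = (m / (n + 1) + 1) * (n + 1) := by nlinarith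
      have h1 : (m + 1) / (n + 1) = m / (n + 1) + 1 := by
        rw [h0, Nat.mul_div_cancel _ n.succ_pos]
      have h2 : (m + 1) % (n + 1) = 0 := by
        rw [h0, Nat.mul_mod_left]
      have h3 : waveAngle n m + π / 2 * (1 / (n + 1)) = π / 2 := by
        have : ((m % (n + 1) : ℕ) : ℝ) + 1 = n + 1 := by exact_mod_cast h
        rw [waveAngle, ← mul_add, ← add_div, this, div_self hn.ne', mul_one]
      rw [h3, wave, waveAngle, h1, h2]
      simp [pairVec]
  · rw [add_sub_cancel_left, abs_of_nonneg (by positivity), mul_one_div]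
    gcongr
    linarith [pi_le_four]

theorem norm_wave (n m : ℕ) : ‖wave n m‖ = 1 := by
  have h := inner_self_eq_norm_sq_to_K (𝕜 := ℂ) (wave n m)
  rw [wave, inner_pairVec, ← pow_two, ← pow_two, cos_sq_add_sin_sq, ← wave] at h
  have h' : (1 : ℝ) = ‖wave n m‖ ^ 2 := by
    refine Complex.ofReal_injective (h.trans ?_)
    rw [Complex.ofReal_pow]
    rfl
  exact (pow_eq_one_iff_of_nonneg (norm_nonneg _) two_ne_zero).mp h'.symm

/-- The index set of the orthonormal basis of the range of the `n`-th projection. -/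
abbrev FamilyIndex (n : ℕ) : Type := siteBox n ⊕ Fin ((n + 1) ^ 2 + 1)

/-- The orthonormal basis of the range of the `n`-th projection. -/
def siteFamily (n : ℕ) : FamilyIndex n → SiteSpace :=
  Sum.elim (fun i => lp.single 2 i 1) fun m => wave n m

/-- The permutation along which the shift moves the family. -/
def familyRotate (n : ℕ) : Equiv.Perm (FamilyIndex n) :=
  Equiv.sumCongr (siteRotate.subtypePerm (siteRotate_mem_siteBox_iff n)) (finRotate _)

theorem siteFamily_inl {n j m s : ℕ} (h : (j, m, s) ∈ siteBox n) :
    siteFamily n (.inl ⟨(j, m, s), h⟩) = pairVec j m s 1 0 := by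
  rw [pairVec_one_zero]
  rfl

theorem siteFamily_inr (n : ℕ) (m : Fin ((n + 1) ^ 2 + 1)) :
    siteFamily n (.inr m) = wave n m := rfl

theorem siteFamily_familyRotate_inl {n j m s : ℕ} (h : (j, m, s) ∈ siteBox n) :
    siteFamily n (familyRotate n (.inl ⟨(j, m, s), h⟩)) =
      pairVec j (rotate ((j + 1) ^ 2 + 1) m) s 1 0 := by
  rw [pairVec_one_zero]
  rfl

theorem siteFamily_familyRotate_inr (n : ℕ) (m : Fin ((n + 1) ^ 2 + 1)) :
    siteFamily n (familyRotate n (.inr m)) = wave n (finRotate _ m) := rfl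

theorem orthonormal_siteFamily (n : ℕ) : Orthonormal ℂ (siteFamily n) := by
  have hne : ∀ (i : siteBox n) (m : ℕ), ((i : ℕ × ℕ × ℕ).1, (i : ℕ × ℕ × ℕ).2.1) ≠ (n, m) := by
    rintro ⟨⟨j, m, s⟩, hi⟩ m' h
    have := (mem_siteBox.mp hi).1
    simp_all
  constructor
  · rintro (i | m)
    · exact (lp.norm_single (by norm_num) _ _).trans norm_one
    · exact norm_wave n m
  · rintro (⟨⟨j, m, s⟩, hi⟩ | m) (⟨⟨j', m', s'⟩, hi'⟩ | m') h
    · exact (inner_single_single _ _).trans (if_neg fun h0 => h (by simp_all))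
    · rw [siteFamily_inl, siteFamily_inr]
      exact inner_pairVec_of_ne (hne ⟨_, hi⟩ m') _ _ _ _
    · rw [siteFamily_inl, siteFamily_inr]
      exact inner_pairVec_of_ne (hne ⟨_, hi'⟩ m).symm _ _ _ _
    · refine inner_pairVec_of_ne (fun h0 => h ?_) _ _ _ _
      simp only [Prod.mk.injEq, true_and] at h0
      rw [Fin.ext h0]

instance (n : ℕ) : FiniteDimensional ℂ (Submodule.span ℂ (Set.range (siteFamily n))) :=
  FiniteDimensional.span_of_finite ℂ (Set.finite_range _)

/-- The `n`-th projection. -/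
def siteProj (n : ℕ) : SiteSpace →L[ℂ] SiteSpace :=
  (Submodule.span ℂ (Set.range (siteFamily n))).starProjection

theorem range_siteProj (n : ℕ) :
    (siteProj n : SiteSpace →ₗ[ℂ] SiteSpace).range = Submodule.span ℂ (Set.range (siteFamily n)) :=
  Submodule.range_starProjection _

theorem siteProj_apply (n : ℕ) (f : SiteSpace) :
    siteProj n f = ∑ a, ⟪siteFamily n a, f⟫_ℂ • siteFamily n a := by
  have hmem : ∑ a, ⟪siteFamily n a, f⟫_ℂ • siteFamily n a ∈
      Submodule.span ℂ (Set.range (siteFamily n)) :=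
    Submodule.sum_mem _ fun a _ => Submodule.smul_mem _ _ (Submodule.subset_span ⟨a, rfl⟩)
  refine Submodule.eq_starProjection_of_mem_of_inner_eq_zero hmem ?_
  intro w hw
  induction hw using Submodule.span_induction with
  | mem x hx =>
    obtain ⟨a, rfl⟩ := hx
    rw [inner_sub_left, sum_inner]
    simp [inner_smul_left, orthonormal_iff_ite.mp (orthonormal_siteFamily n)]
  | zero => exact inner_zero_right _
  | add x y _ _ hx hy => rw [inner_add_right, hx, hy, add_zero]
  | smul c x _ hx => rw [inner_smul_right, hx, mul_zero]

theorem single_mem_span_siteFamily {n : ℕ} {i : ℕ × ℕ × ℕ} (h : i ∈ siteBox n) (c : ℂ) :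
    lp.single 2 i c ∈ Submodule.span ℂ (Set.range (siteFamily n)) := by
  have : (lp.single 2 i c : SiteSpace) = c • siteFamily n (.inl ⟨i, h⟩) := by
    rw [siteFamily, Sum.elim_inl, ← lp.single_smul, smul_eq_mul, mul_one]
  rw [this]
  exact Submodule.smul_mem _ _ (Submodule.subset_span ⟨_, rfl⟩)

theorem span_siteFamily_mono :
    Monotone fun n => Submodule.span ℂ (Set.range (siteFamily n)) := by
  refine monotone_nat_of_le_succ fun n => Submodule.span_le.mpr ?_
  rintro _ ⟨⟨⟨j, m, s⟩, hi⟩ | m, rfl⟩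
  · refine single_mem_span_siteFamily ?_ 1
    rw [mem_siteBox] at hi ⊢
    have : n ^ 2 ≤ (n + 1) ^ 2 := Nat.pow_le_pow_left n.le_succ 2
    lia
  · have hm : (m : ℕ) < (n + 1) ^ 2 + 1 := m.isLt
    have hq : (m : ℕ) / (n + 1) ≤ n + 1 := by
      refine Nat.div_le_of_le_mul ?_
      nlinarith
    have h : ∀ s ≤ n + 2, (n, (m : ℕ), s) ∈ siteBox (n + 1) := fun s hs => by
      rw [mem_siteBox]
      lia
    exact add_mem (Submodule.smul_mem _ _ (single_mem_span_siteFamily (h _ (by lia)) 1))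
      (Submodule.smul_mem _ _ (single_mem_span_siteFamily (h _ (by lia)) 1))

theorem tendsto_siteProj (f : SiteSpace) : Tendsto (fun n => siteProj n f) atTop (𝓝 f) := by
  refine Submodule.starProjection_tendsto_self _ span_siteFamily_mono f fun g _ => ?_
  refine (Submodule.isClosed_topologicalClosure _).mem_of_tendsto
    (lp.hasSum_single (by norm_num) g) (Eventually.of_forall fun t => ?_)
  refine Submodule.le_topologicalClosure _ (Submodule.sum_mem _ fun i _ => ?_)
  obtain ⟨j, m, s⟩ := i
  refine Submodule.mem_iSup_of_mem (j + m + s + 1) (single_mem_span_siteFamily ?_ _)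
  rw [mem_siteBox]
  have := Nat.zero_le ((j + m + s + 1) ^ 2)
  lia

end Projections

section Estimates

open Real

theorem exists_wave_finRotate {n : ℕ} {m : Fin ((n + 1) ^ 2 + 1)} (hm : m ≠ Fin.last _) :
    ∃ θ : ℝ, wave n (finRotate _ m) =
        pairVec n (rotate ((n + 1) ^ 2 + 1) m) (m / (n + 1)) (cos θ) (sin θ) ∧
      |θ - waveAngle n m| ≤ 2 / (n + 1) := by
  rw [rotate_coe, coe_finRotate_of_ne_last hm]
  exact exists_wave_succ n m

theorem wave_last (n : ℕ) : wave n (Fin.last ((n + 1) ^ 2)) =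
    pairVec n (Fin.last ((n + 1) ^ 2)) (n + 1) 1 0 :=
  wave_sq n

theorem wave_finRotate_last (n : ℕ) : wave n (finRotate _ (Fin.last ((n + 1) ^ 2))) =
    pairVec n (rotate ((n + 1) ^ 2 + 1) (Fin.last ((n + 1) ^ 2))) 0 1 0 := by
  rw [rotate_coe, finRotate_last]
  exact wave_zero n

theorem pairVec_zero (j m s : ℕ) : pairVec j m s 0 0 = 0 := by
  simp [pairVec]

theorem coupling_error_le {j s : ℕ} {θ θ' : ℝ} (h : |θ' - θ| ≤ 2 / (j + 1)) :
    |coupling j s * cos θ - coupling j s * cos θ'| +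
      |coupling j (s + 1) * sin θ - coupling j s * sin θ'| ≤ 7 / (j + 1) := by
  rw [abs_sub_comm] at h
  have h1 : |coupling j s * cos θ - coupling j s * cos θ'| ≤ 2 / (j + 1) := by
    rw [← mul_sub, abs_mul]
    exact (mul_le_of_le_one_left (abs_nonneg _) (abs_coupling_le _ _)).trans
      ((abs_cos_sub_cos_le _ _).trans h)
  have h2 : |(coupling j (s + 1) - coupling j s) * sin θ| ≤ 3 / (j + 1) := by
    rw [abs_mul]
    exact (mul_le_of_le_one_right (abs_nonneg _) (abs_sin_le_one _)).trans
      (abs_coupling_succ_sub_le _ _)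
  have h3 : |coupling j s * (sin θ - sin θ')| ≤ 2 / (j + 1) := by
    rw [abs_mul]
    exact (mul_le_of_le_one_left (abs_nonneg _) (abs_coupling_le _ _)).trans
      ((abs_sin_sub_sin_le _ _).trans h)
  have h4 : |coupling j (s + 1) * sin θ - coupling j s * sin θ'| ≤ 3 / (j + 1) + 2 / (j + 1) := by
    rw [show coupling j (s + 1) * sin θ - coupling j s * sin θ' =
      (coupling j (s + 1) - coupling j s) * sin θ + coupling j s * (sin θ - sin θ') by ring]
    exact (abs_add_le _ _).trans (add_le_add h2 h3)
  refine (add_le_add h1 h4).trans_eq ?_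
  ring

/-- Error vectors that vanish on full sites and live on distinct rows on waves. -/
theorem pairwise_inner_eq_zero_of_pairVec {n : ℕ} {χ : FamilyIndex n → SiteSpace}
    {τ : Fin ((n + 1) ^ 2 + 1) → ℕ} (hτ : Function.Injective τ) {ε : ℝ} (hε : 0 ≤ ε)
    (h₀ : ∀ i, χ (.inl i) = 0)
    (h : ∀ m, ∃ s c d, χ (.inr m) = pairVec n (τ m) s c d ∧ |c| + |d| ≤ ε) :
    (Pairwise fun a b => ⟪χ a, χ b⟫_ℂ = 0) ∧ ∀ a, ‖χ a‖ ≤ ε := by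
  constructor
  · rintro (i | m) (i' | m') hne
    · simp [h₀]
    · simp [h₀]
    · simp [h₀]
    · obtain ⟨s, c, d, e, -⟩ := h m
      obtain ⟨s', c', d', e', -⟩ := h m'
      rw [e, e']
      exact inner_pairVec_of_ne (fun h0 => hne (by rw [hτ (Prod.ext_iff.mp h0).2])) _ _ _ _
  · rintro (i | m)
    · rwa [h₀, norm_zero]
    · obtain ⟨s, c, d, e, hcd⟩ := h m
      rw [e]
      exact (norm_pairVec_le _ _ _ _ _).trans hcd

theorem norm_commutator_shiftOp_le (n : ℕ) :
    ‖siteProj n * shiftOp - shiftOp * siteProj n‖ ≤ 2 * (7 / (n + 1)) := by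
  have hε : (0 : ℝ) ≤ 7 / (n + 1) := by positivity
  let ρ : FamilyIndex n → ℝ := Sum.elim (fun i => coupling i.1.1 i.1.2.2)
    fun m => if m = Fin.last _ then 0 else coupling n (m / (n + 1))
  have hρ : ∀ m, m ≠ Fin.last _ → ρ (.inr m) = coupling n (m / (n + 1)) := fun m hm => if_neg hm
  have hρ' : ρ (.inr (Fin.last _)) = 0 := if_pos rfl
  obtain ⟨ho, hn⟩ := pairwise_inner_eq_zero_of_pairVec (n := n)
    (χ := fun a => shiftOp (siteFamily n a) - (ρ a : ℂ) • siteFamily n (familyRotate n a))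
    (τ := fun m => rotate ((n + 1) ^ 2 + 1) m)
    (fun m m' h => Fin.ext ((rotate _).injective h)) hε (by
      rintro ⟨⟨j, m, s⟩, hi⟩
      rw [siteFamily_inl, siteFamily_familyRotate_inl, shiftOp_pairVec, pairVec_sub_smul]
      simp [ρ, pairVec]) (by
      intro m
      rw [siteFamily_inr, siteFamily_familyRotate_inr]
      by_cases hm : m = Fin.last _
      · subst hm
        refine ⟨0, 0, 0, ?_, by simpa using hε⟩
        rw [wave_last, shiftOp_pairVec, hρ', coupling_self]
        simp [pairVec]
      · obtain ⟨θ, hθ, hle⟩ := exists_wave_finRotate hm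
        refine ⟨m / (n + 1), _, _, ?_, coupling_error_le (s := m / (n + 1)) hle⟩
        rw [hθ, wave, shiftOp_pairVec, hρ m hm, pairVec_sub_smul])
  obtain ⟨ho', hn'⟩ := pairwise_inner_eq_zero_of_pairVec (n := n)
    (χ := fun a => shiftOp.adjoint (siteFamily n (familyRotate n a)) - (ρ a : ℂ) • siteFamily n a)
    (τ := fun m => m) (fun m m' h => Fin.ext h) hε (by
      rintro ⟨⟨j, m, s⟩, hi⟩
      rw [siteFamily_inl, siteFamily_familyRotate_inl, adjoint_shiftOp_pairVec, pairVec_sub_smul]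
      simp [ρ, pairVec]) (by
      intro m
      rw [siteFamily_inr, siteFamily_familyRotate_inr]
      by_cases hm : m = Fin.last _
      · subst hm
        refine ⟨0, 0, 0, ?_, by simpa using hε⟩
        rw [wave_finRotate_last, adjoint_shiftOp_pairVec, hρ', coupling_zero]
        simp [pairVec]
      · obtain ⟨θ, hθ, hle⟩ := exists_wave_finRotate hm
        rw [abs_sub_comm] at hle
        refine ⟨m / (n + 1), _, _, ?_, coupling_error_le (s := m / (n + 1)) hle⟩
        rw [hθ, wave, adjoint_shiftOp_pairVec, hρ m hm, pairVec_sub_smul])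
  exact norm_commutator_le_of_orthonormal (orthonormal_siteFamily n) (siteProj_apply n) shiftOp
    (familyRotate n) ρ hε ho ho' hn hn'

theorem norm_commutator_heightOp_le (n : ℕ) :
    ‖siteProj n * heightOp - heightOp * siteProj n‖ ≤ 2 * (6 / (n + 1)) := by
  have hε : (0 : ℝ) ≤ 6 / (n + 1) := by positivity
  let ρ : FamilyIndex n → ℝ := Sum.elim (fun i => height i.1.1 i.1.2.2)
    fun m => height n (m / (n + 1))
  obtain ⟨ho, hn⟩ := pairwise_inner_eq_zero_of_pairVec (n := n)
    (χ := fun a => heightOp (siteFamily n a) - (ρ a : ℂ) • siteFamily n a)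
    (τ := fun m => m) (fun m m' h => Fin.ext h) hε (by
      rintro ⟨⟨j, m, s⟩, hi⟩
      rw [siteFamily_inl, heightOp_pairVec, pairVec_sub_smul]
      simp [ρ, pairVec]) (by
      intro m
      refine ⟨m / (n + 1), _, _, (by
        rw [siteFamily_inr, wave, heightOp_pairVec, pairVec_sub_smul]), ?_⟩
      · simp only [ρ, Sum.elim_inr, sub_self, abs_zero, zero_add, ← sub_mul]
        rw [abs_mul]
        exact (mul_le_of_le_one_right (abs_nonneg _) (abs_sin_le_one _)).trans
          (abs_height_succ_sub_le _ _))
  refine norm_commutator_le_of_orthonormal (orthonormal_siteFamily n) (siteProj_apply n) heightOp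
    (Equiv.refl _) ρ hε ho ?_ hn ?_
  · rwa [adjoint_heightOp]
  · rwa [adjoint_heightOp]

theorem inner_heightOp_siteFamily {n : ℕ} (a b : FamilyIndex n) (h : a ≠ b) :
    ⟪heightOp (siteFamily n a), siteFamily n b⟫_ℂ = 0 := by
  have ho := orthonormal_siteFamily n
  rcases a with ⟨⟨j, m, s⟩, hi⟩ | m
  · have : heightOp (siteFamily n (.inl ⟨(j, m, s), hi⟩)) =
        (height j s : ℂ) • siteFamily n (.inl ⟨(j, m, s), hi⟩) := by
      rw [siteFamily_inl, heightOp_pairVec]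
      simp [pairVec]
    rw [this, inner_smul_left, ho.2 h, mul_zero]
  rcases b with ⟨⟨j', m', s'⟩, hi'⟩ | m'
  · have : heightOp (siteFamily n (.inl ⟨(j', m', s'), hi'⟩)) =
        (height j' s' : ℂ) • siteFamily n (.inl ⟨(j', m', s'), hi'⟩) := by
      rw [siteFamily_inl, heightOp_pairVec]
      simp [pairVec]
    rw [← adjoint_heightOp, ContinuousLinearMap.adjoint_inner_left, this, inner_smul_right,
      ho.2 h, mul_zero]
  · rw [siteFamily_inr, siteFamily_inr, wave, wave, heightOp_pairVec]
    refine inner_pairVec_of_ne (fun h0 => h ?_) _ _ _ _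
    rw [Fin.ext (Prod.ext_iff.mp h0).2]

theorem inner_shiftOp_siteFamily {n : ℕ} (a b : FamilyIndex n) (h : a ≠ b) :
    ⟪shiftOp (siteFamily n a), siteFamily n (familyRotate n b)⟫_ℂ = 0 := by
  have ho := orthonormal_siteFamily n
  have hab : familyRotate n a ≠ familyRotate n b := (familyRotate n).injective.ne h
  rcases a with ⟨⟨j, m, s⟩, hi⟩ | m
  · have : shiftOp (siteFamily n (.inl ⟨(j, m, s), hi⟩)) =
        (coupling j s : ℂ) • siteFamily n (familyRotate n (.inl ⟨(j, m, s), hi⟩)) := by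
      rw [siteFamily_inl, shiftOp_pairVec, siteFamily_familyRotate_inl]
      simp [pairVec]
    rw [this, inner_smul_left, ho.2 hab, mul_zero]
  rcases b with ⟨⟨j', m', s'⟩, hi'⟩ | m'
  · have : shiftOp.adjoint (siteFamily n (familyRotate n (.inl ⟨(j', m', s'), hi'⟩))) =
        (coupling j' s' : ℂ) • siteFamily n (.inl ⟨(j', m', s'), hi'⟩) := by
      rw [siteFamily_familyRotate_inl, adjoint_shiftOp_pairVec, siteFamily_inl]
      simp [pairVec]
    rw [← ContinuousLinearMap.adjoint_inner_right, this, inner_smul_right, ho.2 h, mul_zero]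
  · rw [siteFamily_inr, siteFamily_familyRotate_inr, wave, wave, shiftOp_pairVec, rotate_coe]
    refine inner_pairVec_of_ne (fun h0 => hab ?_) _ _ _ _
    exact congrArg Sum.inr (Fin.ext (Prod.ext_iff.mp h0).2)

theorem inner_heightOp_pairVec {j m s : ℕ} {θ : ℝ} :
    ⟪heightOp (pairVec j m s (cos θ) (sin θ)), pairVec j m s (cos θ) (sin θ)⟫_ℂ =
      ((height j s + (height j (s + 1) - height j s) * sin θ ^ 2 : ℝ) : ℂ) := by
  rw [heightOp_pairVec, inner_pairVec]
  congr 1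
  linear_combination height j s * cos_sq_add_sin_sq θ

theorem abs_height_error_le (j s : ℕ) (θ : ℝ) :
    |height j s + (height j (s + 1) - height j s) * sin θ ^ 2 - height j s| ≤ 6 / (j + 1) := by
  rw [add_sub_cancel_left, abs_mul, abs_sq]
  exact (mul_le_of_le_one_right (abs_nonneg _) (sin_sq_le_one _)).trans
    (abs_height_succ_sub_le _ _)

theorem abs_coupling_form_error_le {j s : ℕ} {θ θ' : ℝ} (h : |θ' - θ| ≤ 2 / (j + 1)) :
    |coupling j s * cos θ * cos θ' + coupling j (s + 1) * sin θ * sin θ' - coupling j s| ≤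
      6 / (j + 1) := by
  have h1 : |coupling j s * (cos (θ' - θ) - 1)| ≤ 2 / (j + 1) := by
    rw [abs_mul]
    refine (mul_le_of_le_one_left (abs_nonneg _) (abs_coupling_le _ _)).trans ?_
    simpa using (abs_cos_sub_cos_le (θ' - θ) 0).trans (by simpa using h)
  have h2 : |(coupling j (s + 1) - coupling j s) * (sin θ * sin θ')| ≤ 3 / (j + 1) := by
    rw [abs_mul, abs_mul]
    exact (mul_le_of_le_one_right (abs_nonneg _) (mul_le_one₀ (abs_sin_le_one _) (abs_nonneg _)
      (abs_sin_le_one _))).trans (abs_coupling_succ_sub_le _ _)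
  have e : coupling j s * cos θ * cos θ' + coupling j (s + 1) * sin θ * sin θ' - coupling j s =
      coupling j s * (cos (θ' - θ) - 1) +
        (coupling j (s + 1) - coupling j s) * (sin θ * sin θ') := by
    rw [cos_sub]
    ring
  rw [e]
  calc _ ≤ 2 / ((j : ℝ) + 1) + 3 / (j + 1) := (abs_add_le _ _).trans (add_le_add h1 h2)
    _ = 5 / (j + 1) := by ring
    _ ≤ 6 / (j + 1) := by gcongr; norm_num

theorem one_div_sixteen_le_commutingDist {n : ℕ} (hn : 48 ≤ n) {A₁ A₂ : SiteSpace →L[ℂ] SiteSpace}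
    (hA : A₁ + Complex.I • A₂ = shiftOp) :
    1 / 4 / 4 ≤ commutingDist (siteProj n * A₁ * siteProj n) (siteProj n * A₂ * siteProj n)
      (siteProj n * heightOp * siteProj n) := by
  classical
  have hsmall : (6 : ℝ) / (n + 1) ≤ 1 / 8 := by
    have : (48 : ℝ) ≤ n := by exact_mod_cast hn
    rw [div_le_div_iff₀ (by positivity) (by norm_num)]
    linarith
  -- the diagonal data of the two operators
  have hh : ∀ a, ∃ h : ℝ, ⟪heightOp (siteFamily n a), siteFamily n a⟫_ℂ = h := by
    rintro (⟨⟨j, m, s⟩, hi⟩ | m)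
    · rw [siteFamily_inl, heightOp_pairVec, inner_pairVec]
      exact ⟨_, rfl⟩
    · exact ⟨_, inner_heightOp_pairVec⟩
  have hr : ∀ a, ∃ r : ℝ,
      ⟪shiftOp (siteFamily n a), siteFamily n (familyRotate n a)⟫_ℂ = r := by
    rintro (⟨⟨j, m, s⟩, hi⟩ | m)
    · rw [siteFamily_inl, siteFamily_familyRotate_inl, shiftOp_pairVec, inner_pairVec]
      exact ⟨_, rfl⟩
    · rw [siteFamily_inr, siteFamily_familyRotate_inr]
      by_cases hm : m = Fin.last _
      · subst hm
        rw [wave_last, shiftOp_pairVec, coupling_self, zero_mul, mul_zero, pairVec_zero,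
          inner_zero_left]
        exact ⟨0, rfl⟩
      · obtain ⟨θ, hθ, -⟩ := exists_wave_finRotate hm
        rw [hθ, wave, shiftOp_pairVec, inner_pairVec]
        exact ⟨_, rfl⟩
  choose h hh using hh
  choose r hr using hr
  have hval : ∀ a {t : ℝ}, ⟪heightOp (siteFamily n a), siteFamily n a⟫_ℂ = t → h a = t :=
    fun a t ht => Complex.ofReal_injective ((hh a).symm.trans ht)
  have rval : ∀ a {t : ℝ}, ⟪shiftOp (siteFamily n a), siteFamily n (familyRotate n a)⟫_ℂ = t →
      r a = t := fun a t ht => Complex.ofReal_injective ((hr a).symm.trans ht)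
  refine le_commutingDist fun K₁ K₂ K₃ => le_dist_commuting_of_orthonormal
    (orthonormal_siteFamily n) (siteProj_apply n) (familyRotate n) h r ?_ ?_ (by norm_num)
    (.inr (Fin.last _)) ?_ ?_ ?_ ?_
  · intro a b
    split_ifs with hab
    · rw [← hab, hh]
    · exact inner_heightOp_siteFamily a b hab
  · intro a b
    rw [hA]
    split_ifs with hab
    · rw [← hab, hr]
    · exact inner_shiftOp_siteFamily a b hab
  · rw [hval (t := 1)]
    · norm_num
    · rw [siteFamily_inr, wave_last, heightOp_pairVec, inner_pairVec, height_self]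
      norm_num
  · rw [hval (t := -1)]
    · norm_num
    · rw [siteFamily_familyRotate_inr, wave_finRotate_last, heightOp_pairVec, inner_pairVec,
        height_zero]
      norm_num
  · refine rval _ ?_
    rw [siteFamily_inr, wave_last, shiftOp_pairVec, coupling_self, zero_mul, mul_zero, pairVec_zero,
      inner_zero_left, Complex.ofReal_zero]
  · rintro (⟨⟨j, m, s⟩, hi⟩ | m) ha
    · have e₁ : h (.inl ⟨(j, m, s), hi⟩) = height j s := hval _ (by
        rw [siteFamily_inl, heightOp_pairVec, inner_pairVec]
        norm_num)
      have e₂ : h (familyRotate n (.inl ⟨(j, m, s), hi⟩)) = height j s := hval _ (by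
        rw [siteFamily_familyRotate_inl, heightOp_pairVec, inner_pairVec]
        norm_num)
      have e₃ : r (.inl ⟨(j, m, s), hi⟩) = coupling j s := rval _ (by
        rw [siteFamily_familyRotate_inl, siteFamily_inl, shiftOp_pairVec, inner_pairVec]
        norm_num)
      rw [e₁, e₂, e₃]
      exact exists_phase (j := j) (s := s) (by norm_num) (by norm_num) (by norm_num)
    · have hm : m ≠ Fin.last _ := fun h0 => ha (by rw [h0])
      obtain ⟨θ, hθ, hle⟩ := exists_wave_finRotate hm
      have e₁ := hval (.inr m) inner_heightOp_pairVec
      have e₂ := hval (familyRotate n (.inr m)) (by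
        rw [siteFamily_familyRotate_inr, hθ]
        exact inner_heightOp_pairVec)
      have e₃ := rval (.inr m) (by
        rw [siteFamily_inr, siteFamily_familyRotate_inr, hθ, wave, shiftOp_pairVec, inner_pairVec])
      rw [e₁, e₂, e₃]
      exact exists_phase ((abs_height_error_le _ _ _).trans hsmall)
        ((abs_height_error_le _ _ _).trans hsmall) ((abs_coupling_form_error_le hle).trans hsmall)

end Estimates

theorem exists_commutingDist_bounded_below :
    ∃ (H : Type) (_ : NormedAddCommGroup H) (_ : InnerProductSpace ℂ H) (_ : CompleteSpace H)
      (H₁ H₂ H₃ : H →L[ℂ] H) (P : ℕ → H →L[ℂ] H),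
      IsSelfAdjoint H₁ ∧ IsSelfAdjoint H₂ ∧ IsSelfAdjoint H₃ ∧
      Commute H₁ H₂ ∧ Commute H₁ H₃ ∧ Commute H₂ H₃ ∧
      (∀ k, IsSelfAdjoint (P k) ∧ IsIdempotentElem (P k) ∧
        FiniteDimensional ℂ (P k : H →ₗ[ℂ] H).range) ∧
      (∀ k, (P k : H →ₗ[ℂ] H).range ≤ (P (k + 1) : H →ₗ[ℂ] H).range) ∧
      (∀ v, Tendsto (fun k => P k v) atTop (𝓝 v)) ∧
      Tendsto (fun k => ‖P k * H₁ - H₁ * P k‖) atTop (𝓝 0) ∧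
      Tendsto (fun k => ‖P k * H₂ - H₂ * P k‖) atTop (𝓝 0) ∧
      Tendsto (fun k => ‖P k * H₃ - H₃ * P k‖) atTop (𝓝 0) ∧
      ∃ c : ℝ, 0 < c ∧ ∀ᶠ k in atTop,
        c ≤ commutingDist (P k * H₁ * P k) (P k * H₂ * P k) (P k * H₃ * P k) := by
  have hsa : ∀ n, IsSelfAdjoint (siteProj n) := fun n => isSelfAdjoint_starProjection _
  have := isStarNormal_shiftOp
  have hstar : IsSelfAdjoint heightOp := adjoint_heightOp
  have hc : Commute (star shiftOp) heightOp := by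
    have := commute_heightOp_shiftOp.symm.star_star
    rwa [hstar.star_eq] at this
  have hlim : ∀ c : ℝ, Tendsto (fun n : ℕ => 2 * (c / ((n : ℝ) + 1))) atTop (𝓝 0) := fun c => by
    have := (tendsto_one_div_add_atTop_nhds_zero_nat (𝕜 := ℝ)).const_mul (2 * c)
    rw [mul_zero] at this
    exact this.congr fun n => by ring
  refine ⟨SiteSpace, inferInstance, inferInstance, inferInstance, (realPart shiftOp : _),
    (imaginaryPart shiftOp : _), heightOp, siteProj, (realPart shiftOp).2,
    (imaginaryPart shiftOp).2, hstar, Commute.realPart_imaginaryPart shiftOp, ?_, ?_,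
    fun n => ⟨hsa n, Submodule.isIdempotentElem_starProjection _, ?_⟩, fun n => ?_,
    tendsto_siteProj, ?_, ?_, ?_, 1 / 4 / 4, by norm_num, ?_⟩
  · rw [realPart_apply_coe]
    exact (commute_heightOp_shiftOp.symm.add_left hc).smul_left _
  · rw [imaginaryPart_apply_coe]
    exact ((commute_heightOp_shiftOp.symm.sub_left hc).smul_left _).smul_left _
  · rw [range_siteProj]
    infer_instance
  · rw [range_siteProj, range_siteProj]
    exact span_siteFamily_mono n.le_succ
  · exact squeeze_zero (fun _ => norm_nonneg _) (fun n =>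
      ((hsa n).norm_commutator_realPart_le _).trans (norm_commutator_shiftOp_le n)) (hlim 7)
  · exact squeeze_zero (fun _ => norm_nonneg _) (fun n =>
      ((hsa n).norm_commutator_imaginaryPart_le _).trans (norm_commutator_shiftOp_le n)) (hlim 7)
  · exact squeeze_zero (fun _ => norm_nonneg _) norm_commutator_heightOp_le (hlim 6)
  · filter_upwards [eventually_ge_atTop 48] with n hn
    exact one_div_sixteen_le_commutingDist hn (realPart_add_I_smul_imaginaryPart shiftOp)

/-- Theorem (`thm:cutdownExample`): there exist a complex Hilbert space `ℋ`, bounded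
commuting self-adjoint operators `H₁, H₂, H₃` on `ℋ`, and an increasing sequence of
finite-rank orthogonal projections `Pₙ` converging strongly to the identity and
asymptotically commuting with each `Hᵣ`, such that the distance
`dₙ = inf { ‖K₁ − PₙH₁Pₙ‖ + ‖K₂ − PₙH₂Pₙ‖ + ‖K₃ − PₙH₃Pₙ‖ }` over commuting triples of
bounded self-adjoint operators `(K₁,K₂,K₃)` tends to `1`. -/
theorem cutdown_example :
    ∃ (H : Type) (_ : NormedAddCommGroup H) (_ : InnerProductSpace ℂ H)
      (_ : CompleteSpace H)
      (H₁ H₂ H₃ : H →L[ℂ] H) (P : ℕ → H →L[ℂ] H),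
      IsSelfAdjoint H₁ ∧ IsSelfAdjoint H₂ ∧ IsSelfAdjoint H₃ ∧
      Commute H₁ H₂ ∧ Commute H₁ H₃ ∧ Commute H₂ H₃ ∧
      (∀ k, IsSelfAdjoint (P k) ∧ IsIdempotentElem (P k) ∧
        FiniteDimensional ℂ (LinearMap.range ((P k : H →L[ℂ] H) : H →ₗ[ℂ] H))) ∧
      (∀ k, LinearMap.range ((P k : H →L[ℂ] H) : H →ₗ[ℂ] H) ≤
        LinearMap.range ((P (k + 1) : H →L[ℂ] H) : H →ₗ[ℂ] H)) ∧
      (∀ v : H, Filter.Tendsto (fun k => P k v) Filter.atTop (nhds v)) ∧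
      (Filter.Tendsto (fun k => ‖P k * H₁ - H₁ * P k‖) Filter.atTop (nhds 0)) ∧
      (Filter.Tendsto (fun k => ‖P k * H₂ - H₂ * P k‖) Filter.atTop (nhds 0)) ∧
      (Filter.Tendsto (fun k => ‖P k * H₃ - H₃ * P k‖) Filter.atTop (nhds 0)) ∧
      Filter.Tendsto (fun k => sInf { d : ℝ |
          ∃ K₁ K₂ K₃ : H →L[ℂ] H,
            IsSelfAdjoint K₁ ∧ IsSelfAdjoint K₂ ∧ IsSelfAdjoint K₃ ∧
            Commute K₁ K₂ ∧ Commute K₁ K₃ ∧ Commute K₂ K₃ ∧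
            d = ‖K₁ - P k * H₁ * P k‖ + ‖K₂ - P k * H₂ * P k‖ +
                ‖K₃ - P k * H₃ * P k‖ })
        Filter.atTop (nhds 1) := by
  obtain ⟨H, i₁, i₂, i₃, H₁, H₂, H₃, P, s₁, s₂, s₃, c₁₂, c₁₃, c₂₃, hP, hmono, hstrong, l₁, l₂, l₃,
    c, hc, hd⟩ := exists_commutingDist_bounded_below
  obtain ⟨t, -, φ, hφ, hlim⟩ :=
    exists_subseq_tendsto_commutingDist (fun k => (hP k).1) (fun k => (hP k).2.1) hc hd
  have hs : ∀ {K : H →L[ℂ] H}, IsSelfAdjoint K → IsSelfAdjoint ((t : ℂ) • K) :=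
    fun hK => IsSelfAdjoint.smul (Complex.conj_ofReal _) hK
  have hcomm : ∀ {K L : H →L[ℂ] H}, Commute K L → Commute ((t : ℂ) • K) ((t : ℂ) • L) :=
    fun h => (h.smul_left _).smul_right _
  have hl : ∀ {A : H →L[ℂ] H}, Tendsto (fun k => ‖P k * A - A * P k‖) atTop (𝓝 0) →
      Tendsto (fun k => ‖P (φ k) * ((t : ℂ) • A) - ((t : ℂ) • A) * P (φ k)‖) atTop (𝓝 0) := by
    intro A hA
    have := (hA.comp hφ.tendsto_atTop).const_mul ‖(t : ℂ)‖
    rw [mul_zero] at this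
    refine this.congr fun k => ?_
    simp only [Function.comp_apply, mul_smul_comm, smul_mul_assoc, ← smul_sub, norm_smul]
  exact ⟨H, i₁, i₂, i₃, _, _, _, fun k => P (φ k), hs s₁, hs s₂, hs s₃, hcomm c₁₂, hcomm c₁₃,
    hcomm c₂₃, fun k => hP _,
    fun k => monotone_nat_of_le_succ hmono (hφ.monotone k.le_succ),
    fun v => (hstrong v).comp hφ.tendsto_atTop, hl l₁, hl l₂, hl l₃, hlim⟩
end
end
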